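/- Let T be a complete stable first-order L-theory and suppose T_aut has a model completion T^mc_aut. Then every completion T* of T^mc_aut satisfies NSOP₃: there is no L⁺-formula φ(x̄,ȳ), with x̄ and ȳ tuples of the same length, such that (i) some model of T* contains tuples (ā_k)_{k∈ℕ} with φ(ā_k,ā_m) holding whenever k<m, and (ii) no model of T* contains tuples b̄₀, b̄₁, b̄₂ satisfying φ(b̄₀,b̄₁) ∧ φ(b̄₁,b̄₂) ∧ φ(b̄₂,b̄₀). -/

import Mathlib

namespace FirstOrder

open Language Structure

universe u v w

namespace ShelahE34

/-- The index type for the function symbols of the language consisting of a single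
unary function symbol `σ`. -/
inductive SigmaFunc : ℕ → Type
  | sigma : SigmaFunc 1

/-- The language consisting of a single unary function symbol `σ`. -/
def sigmaLang : Language.{0, 0} :=
  ⟨SigmaFunc, fun _ => Empty⟩

/-- `L⁺`: the language `L` expanded by one new unary function symbol `σ`. -/
abbrev LPlus (L : Language.{u, v}) : Language :=
  L.sum sigmaLang

/-- The new unary function symbol `σ` of `L⁺`. -/
def sigmaSymb (L : Language.{u, v}) : (LPlus L).Functions 1 :=
  Sum.inr SigmaFunc.sigma

/-- Application of the symbol `σ` to a term of `L⁺`. -/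
def sigmaTerm {L : Language.{u, v}} {α : Type w} (t : (LPlus L).Term α) : (LPlus L).Term α :=
  Functions.apply₁ (sigmaSymb L) t

/-- The interpretation of the symbol `σ` in an `L⁺`-structure, as a function. -/
def sigmaMap (L : Language.{u, v}) (N : Type w) [(LPlus L).Structure N] : N → N :=
  fun x => funMap (sigmaSymb L) ![x]

/-- The sentence `(∀x)(∀y)(σ(x) = σ(y) → x = y)`. -/
def sigmaInj (L : Language.{u, v}) : (LPlus L).Sentence :=
  ∀' ∀' ((sigmaTerm (&0) =' sigmaTerm (&1)) ⟹ ((&0) =' (&1)))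

/-- The sentence `(∀y)(∃x)(σ(x) = y)`. -/
def sigmaSurj (L : Language.{u, v}) : (LPlus L).Sentence :=
  ∀' ∃' (sigmaTerm (&1) =' (&0))

/-- The sentence `(∀x̄)(F(σ(x̄)) = σ(F(x̄)))` for a function symbol `F` of `L`. -/
def funCommSentence (L : Language.{u, v}) {n : ℕ} (F : L.Functions n) : (LPlus L).Sentence :=
  BoundedFormula.alls
    (sigmaTerm (Term.func (Sum.inl F : (LPlus L).Functions n) fun i => Term.var (Sum.inr i)) ='
      Term.func (Sum.inl F : (LPlus L).Functions n) fun i => sigmaTerm (Term.var (Sum.inr i)))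

/-- The sentence `(∀x̄)(R(x̄) ↔ R(σ(x̄)))` for a relation symbol `R` of `L`. -/
def relPresSentence (L : Language.{u, v}) {n : ℕ} (R : L.Relations n) : (LPlus L).Sentence :=
  BoundedFormula.alls
    ((Relations.boundedFormula (Sum.inl R : (LPlus L).Relations n)
        fun i => Term.var (Sum.inr i)) ⇔
      Relations.boundedFormula (Sum.inl R : (LPlus L).Relations n)
        fun i => sigmaTerm (Term.var (Sum.inr i)))

/-- `T_aut`: the `L⁺`-theory consisting of `T` together with the sentences asserting that `σ`
is an automorphism. -/
def Taut {L : Language.{u, v}} (T : L.Theory) : (LPlus L).Theory :=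
  (LHom.sumInl : L →ᴸ LPlus L).onTheory T ∪ {sigmaInj L, sigmaSurj L} ∪
    {φ | ∃ (n : ℕ) (F : L.Functions n), φ = funCommSentence L F} ∪
    {φ | ∃ (n : ℕ) (R : L.Relations n), φ = relPresSentence L R}

/-- A theory is complete and consistent if it is satisfiable and semantically decides every
sentence. -/
def SemComplete {L' : Language.{u, v}} (U : L'.Theory) : Prop :=
  U.IsSatisfiable ∧ ∀ φ : L'.Sentence, U ⊨ᵇ φ ∨ U ⊨ᵇ ∼φ

/-- A completion of a theory `S`: a complete consistent theory in the same language
containing `S`. -/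
def IsCompletionOf {L' : Language.{u, v}} (S U : L'.Theory) : Prop :=
  S ⊆ U ∧ SemComplete U

/-- The atomic diagram of a structure `M`: all atomic and negated atomic sentences with
constants from `M` that hold in `M`. -/
def atomicDiagram (L' : Language.{u, v}) (M : Type w) [L'.Structure M] : (L'[[M]]).Theory :=
  {φ | (φ.IsAtomic ∨ ∃ ψ : (L'[[M]]).Sentence, ψ.IsAtomic ∧ φ = ∼ψ) ∧ M ⊨ φ}

/-- `Tstar` is a model completion of `S`: it contains `S`, every model of `S` embeds into a
model of `Tstar`, and for every model `M` of `S`, `Tstar` together with the atomic diagram of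
`M` is a complete consistent theory. -/
def IsModelCompletion.{u', v', w'} {L' : Language.{u', v'}} (S Tstar : L'.Theory) : Prop :=
  S ⊆ Tstar ∧
    (∀ M : Theory.ModelType.{u', v', w'} S, ∃ N : Theory.ModelType.{u', v', w'} Tstar,
      Nonempty (M ↪[L'] N)) ∧
    ∀ M : Theory.ModelType.{u', v', w'} S,
      SemComplete ((L'.lhomWithConstants M).onTheory Tstar ∪ atomicDiagram L' M)

/-- A formula has the order property with respect to a theory `S` if in some model of `S`
there are tuples `(ā_i)` and `(b̄_j)` such that `φ(ā_i, b̄_j)` holds iff `i < j`. -/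
def HasOrderProperty.{u', v', w'} {L' : Language.{u', v'}} (S : L'.Theory) : Prop :=
  ∃ (nx ny : ℕ) (φ : L'.Formula (Fin nx ⊕ Fin ny)) (N : Theory.ModelType.{u', v', w'} S)
    (a : ℕ → Fin nx → N) (b : ℕ → Fin ny → N),
    ∀ i j : ℕ, φ.Realize (Sum.elim (a i) (b j)) ↔ i < j

/-- A theory is stable if no formula has the order property with respect to it. -/
def IsStableTheory.{u', v', w'} {L' : Language.{u', v'}} (S : L'.Theory) : Prop :=
  ¬ HasOrderProperty.{u', v', w'} S

/-- A theory `S` has SOP₃ if there is a formula `φ(x̄, ȳ)` (with `x̄`, `ȳ` of the same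
length) such that some model of `S` contains an infinite `φ`-chain, while no model of `S`
contains a `φ`-3-cycle. -/
def HasSOP3.{u', v', w'} {L' : Language.{u', v'}} (S : L'.Theory) : Prop :=
  ∃ (n : ℕ) (φ : L'.Formula (Fin n ⊕ Fin n)),
    (∃ (N : Theory.ModelType.{u', v', w'} S) (a : ℕ → Fin n → N),
      ∀ k m : ℕ, k < m → φ.Realize (Sum.elim (a k) (a m))) ∧
    ∀ (N : Theory.ModelType.{u', v', w'} S) (b₀ b₁ b₂ : Fin n → N),
      ¬ (φ.Realize (Sum.elim b₀ b₁) ∧ φ.Realize (Sum.elim b₁ b₂) ∧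
          φ.Realize (Sum.elim b₂ b₀))


section Util

variable {L : Language.{u, v}}

/-- Every formula only uses finitely many variables: existential quantification over an
arbitrary family of variables is expressible. -/
theorem exists_ex {α β : Type w} (χ : L.Formula (α ⊕ β)) :
    ∃ ψ : L.Formula β, ∀ (M : Type w) [L.Structure M] [Nonempty M] (v : β → M),
      ψ.Realize v ↔ ∃ u : α → M, χ.Realize (Sum.elim u v) := by
  classical
  let γ := {a : α // Sum.inl a ∈ χ.freeVarFinset}
  haveI : Finite γ := by
    have : Finite χ.freeVarFinset := inferInstance
    exact Finite.of_injective (fun a : γ => (⟨Sum.inl a.1, a.2⟩ : χ.freeVarFinset))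
      (fun a b h => by
        have := congrArg Subtype.val h
        exact Subtype.ext (Sum.inl_injective this))
  let f : χ.freeVarFinset → β ⊕ γ := fun x =>
    Sum.casesOn (motive := fun y => y ∈ χ.freeVarFinset → β ⊕ γ) x.1
      (fun a ha => Sum.inr ⟨a, ha⟩) (fun b _ => Sum.inl b) x.2
  let χ' : L.Formula (β ⊕ γ) := χ.restrictFreeVar f
  refine ⟨χ'.iExs γ, fun M _ _ v => ?_⟩
  rw [Formula.realize_iExs]
  constructor
  · rintro ⟨i, hi⟩
    refine ⟨fun a => if h : Sum.inl a ∈ χ.freeVarFinset then i ⟨a, h⟩ else Classical.arbitrary M, ?_⟩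
    refine (BoundedFormula.realize_restrictFreeVar _ ?_).1 hi
    rintro ⟨a | b, h⟩
    · simp [f, h]
    · simp [f]
  · rintro ⟨u, hu⟩
    refine ⟨fun a => u a.1, ?_⟩
    refine (BoundedFormula.realize_restrictFreeVar (Sum.elim u v) ?_).2 hu
    rintro ⟨a | b, h⟩
    · simp [f]
    · simp [f]

/-- Reduction of a formula in two arbitrary families of variables to finitely many. -/
theorem exists_fin {α β : Type w} (θ : L.Formula (α ⊕ β)) :
    ∃ (nx ny : ℕ) (θ' : L.Formula (Fin nx ⊕ Fin ny)) (p : Fin nx → α) (q : Fin ny → β),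
      ∀ (M : Type w) [L.Structure M] (u : α → M) (v : β → M),
        θ'.Realize (Sum.elim (u ∘ p) (v ∘ q)) ↔ θ.Realize (Sum.elim u v) := by
  classical
  let s := θ.freeVarFinset
  let A : Finset α := s.preimage Sum.inl (Sum.inl_injective.injOn)
  let B : Finset β := s.preimage Sum.inr (Sum.inr_injective.injOn)
  let eA := A.equivFin
  let eB := B.equivFin
  let f : θ.freeVarFinset → Fin A.card ⊕ Fin B.card := fun x =>
    Sum.casesOn (motive := fun y => y ∈ θ.freeVarFinset → Fin A.card ⊕ Fin B.card) x.1
      (fun a ha => Sum.inl (eA ⟨a, by simpa [A, s] using ha⟩))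
      (fun b hb => Sum.inr (eB ⟨b, by simpa [B, s] using hb⟩)) x.2
  refine ⟨A.card, B.card, θ.restrictFreeVar f, fun i => (eA.symm i).1, fun i => (eB.symm i).1,
    fun M _ u v => ?_⟩
  refine BoundedFormula.realize_restrictFreeVar (Sum.elim u v) ?_
  rintro ⟨a | b, h⟩
  · simp [f]
  · simp [f]

end Util

section Tree

variable {C Y : Type*}

/-- Binary trees for a relation `R`, of height `n`, with nodes in `CS` and leaves in `YS`. -/
def Tree (R : C → Y → Prop) : ℕ → Set C → Set Y → Prop
  | 0, _, YS => YS.Nonempty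
  | n + 1, CS, YS => ∃ c ∈ CS, Tree R n CS {y | y ∈ YS ∧ R c y} ∧ Tree R n CS {y | y ∈ YS ∧ ¬ R c y}

theorem Tree.mono {R : C → Y → Prop} : ∀ {n : ℕ} {CS CS' : Set C} {YS YS' : Set Y},
    CS ⊆ CS' → YS ⊆ YS' → Tree R n CS YS → Tree R n CS' YS'
  | 0, _, _, _, _, _, hY, h => Set.Nonempty.mono hY h
  | n + 1, _, _, _, _, hC, hY, ⟨c, hc, h1, h2⟩ =>
    ⟨c, hC hc, Tree.mono hC (fun _ hy => ⟨hY hy.1, hy.2⟩) h1,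
      Tree.mono hC (fun _ hy => ⟨hY hy.1, hy.2⟩) h2⟩

theorem Tree.nonempty {R : C → Y → Prop} : ∀ {n : ℕ} {CS : Set C} {YS : Set Y},
    Tree R n CS YS → YS.Nonempty
  | 0, _, _, h => h
  | _ + 1, _, _, ⟨_, _, h1, _⟩ => (Tree.nonempty h1).mono (fun _ hy => hy.1)

theorem Tree.color {R : C → Y → Prop} (C1 C2 : Set C) : ∀ (k m n : ℕ) (YS : Set Y), m + n = k →
    Tree R k (C1 ∪ C2) YS → Tree R m C1 YS ∨ Tree R n C2 YS
  | 0, 0, _, _, _, h => Or.inl h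
  | 0, _ + 1, _, _, hk, _ => by omega
  | k + 1, 0, n, _, _, h => Or.inl (Tree.nonempty h)
  | k + 1, m + 1, 0, _, _, h => Or.inr (Tree.nonempty h)
  | k + 1, m + 1, n + 1, YS, hk, ⟨c, hc, h1, h2⟩ => by
    have hmono : ∀ P : Y → Prop, {y | y ∈ YS ∧ P y} ⊆ YS := fun P y hy => hy.1
    rcases hc with hc | hc
    · rcases Tree.color C1 C2 k m (n + 1) _ (by omega) h1 with a1 | a1
      · rcases Tree.color C1 C2 k m (n + 1) _ (by omega) h2 with a2 | a2
        · exact Or.inl ⟨c, hc, a1, a2⟩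
        · exact Or.inr (Tree.mono subset_rfl (hmono _) a2)
      · exact Or.inr (Tree.mono subset_rfl (hmono _) a1)
    · rcases Tree.color C1 C2 k (m + 1) n _ (by omega) h1 with a1 | a1
      · exact Or.inl (Tree.mono subset_rfl (hmono _) a1)
      · rcases Tree.color C1 C2 k (m + 1) n _ (by omega) h2 with a2 | a2
        · exact Or.inl (Tree.mono subset_rfl (hmono _) a2)
        · exact Or.inr ⟨c, hc, a1, a2⟩

/-- Ladders with prescribed pattern `pat`. -/
def Ladder (R : C → Y → Prop) (pat : ℕ → ℕ → Prop) (p : ℕ) (CS : Set C) (YS : Set Y) : Prop :=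
  ∃ (c : ℕ → C) (y : ℕ → Y), (∀ l < p, c l ∈ CS ∧ y l ∈ YS) ∧
    ∀ l < p, ∀ k < p, R (c l) (y k) ↔ pat l k

theorem Ladder.mono {R : C → Y → Prop} {pat : ℕ → ℕ → Prop} {p : ℕ} {CS CS' : Set C}
    {YS YS' : Set Y} (hC : CS ⊆ CS') (hY : YS ⊆ YS') (h : Ladder R pat p CS YS) :
    Ladder R pat p CS' YS' := by
  obtain ⟨c, y, h1, h2⟩ := h
  exact ⟨c, y, fun l hl => ⟨hC (h1 l hl).1, hY (h1 l hl).2⟩, h2⟩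

theorem Tree.ladder {R : C → Y → Prop} : ∀ (s p q : ℕ), p + q = s → ∃ h : ℕ, ∀ (CS : Set C) (YS : Set Y),
    Tree R h CS YS → Ladder R (fun l k => k ≤ l) p CS YS ∨ Ladder R (fun l k => l < k) q CS YS := by
  intro s
  induction s with
  | zero =>
    intro p q hs
    obtain rfl : p = 0 := by omega
    refine ⟨1, fun CS YS h => Or.inl ?_⟩
    obtain ⟨c, -, h1, -⟩ := h
    obtain ⟨y, -⟩ := Tree.nonempty h1
    exact ⟨fun _ => c, fun _ => y, by simp, by simp⟩
  | succ s ih =>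
    intro p q hs
    have triv : ∀ (pat) (CS : Set C) (YS : Set Y), Tree R 1 CS YS → Ladder R pat 0 CS YS := by
      intro pat CS YS h
      obtain ⟨c, -, h1, -⟩ := h
      obtain ⟨y, -⟩ := Tree.nonempty h1
      exact ⟨fun _ => c, fun _ => y, by simp, by simp⟩
    rcases p with - | p
    · exact ⟨1, fun CS YS h => Or.inl (triv _ _ _ h)⟩
    rcases q with - | q
    · exact ⟨1, fun CS YS h => Or.inr (triv _ _ _ h)⟩
    obtain ⟨h1, H1⟩ := ih p (q + 1) (by omega)
    obtain ⟨h2, H2⟩ := ih (p + 1) q (by omega)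
    refine ⟨(h1 + 1) + (h2 + 1), fun CS YS h => ?_⟩
    obtain ⟨y, hy⟩ := Tree.nonempty h
    have hsub : CS ⊆ {c | c ∈ CS ∧ R c y} ∪ {c | c ∈ CS ∧ ¬ R c y} := by
      intro c hc
      by_cases hr : R c y
      · exact Or.inl ⟨hc, hr⟩
      · exact Or.inr ⟨hc, hr⟩
    rcases Tree.color _ _ _ (h1 + 1) (h2 + 1) YS rfl (Tree.mono hsub subset_rfl h) with t | t
    · obtain ⟨c0, hc0, -, t⟩ := t
      rcases H1 _ _ t with ⟨c, y', m, e⟩ | l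
      · left
        refine ⟨fun n => Nat.casesOn n c0 c, fun n => Nat.casesOn n y y', ?_, ?_⟩
        · rintro (- | l) hl
          · exact ⟨hc0.1, hy⟩
          · exact ⟨(m l (by omega)).1.1, (m l (by omega)).2.1⟩
        · rintro (- | l) hl (- | k) hk
          · simpa using hc0.2
          · simpa using (m k (by omega)).2.2
          · simpa using (m l (by omega)).1.2
          · simpa using e l (by omega) k (by omega)
      · exact Or.inr (l.mono (fun _ h => h.1) (fun _ h => h.1))
    · obtain ⟨c0, hc0, t, -⟩ := t
      rcases H2 _ _ t with l | ⟨c, y', m, e⟩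
      · exact Or.inl (l.mono (fun _ h => h.1) (fun _ h => h.1))
      · right
        refine ⟨fun n => Nat.casesOn n c0 c, fun n => Nat.casesOn n y y', ?_, ?_⟩
        · rintro (- | l) hl
          · exact ⟨hc0.1, hy⟩
          · exact ⟨(m l (by omega)).1.1, (m l (by omega)).2.1⟩
        · rintro (- | l) hl (- | k) hk
          · simpa using hc0.2
          · simpa using (m k (by omega)).2.2
          · simpa using (m l (by omega)).1.2
          · simpa using e l (by omega) k (by omega)

/-- If there are no long ladders, there are no high trees. -/
theorem exists_not_tree {R : C → Y → Prop} {p : ℕ}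
    (hp : ¬ Ladder R (fun l k => l ≤ k) p Set.univ Set.univ) :
    ∃ h, ¬ Tree R h Set.univ Set.univ := by
  obtain ⟨h, H⟩ := Tree.ladder (R := R) _ p (p + 1) rfl
  refine ⟨h, fun t => hp ?_⟩
  rcases H _ _ t with ⟨c, y, -, e⟩ | ⟨c, y, -, e⟩
  · refine ⟨fun l => c (p - 1 - l), fun l => y (p - 1 - l), by simp, fun l hl k hk => ?_⟩
    rw [e _ (by omega) _ (by omega)]
    omega
  · refine ⟨c, fun l => y (l + 1), by simp, fun l hl k hk => ?_⟩
    rw [e _ (by omega) _ (by omega)]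
    omega

end Tree

section Stability

open Filter

variable {L : Language.{u, v}}

/-- No formula has arbitrarily long ladders in `N`. -/
def NoLadder (L : Language.{u, v}) (N : Type w) [L.Structure N] : Prop :=
  ∀ (α β : Type w) (θ : L.Formula (α ⊕ β)), ∃ p : ℕ,
    ¬ Ladder (fun (c : α → N) (y : β → N) => θ.Realize (Sum.elim c y)) (fun l k => l ≤ k) p
      Set.univ Set.univ

theorem noLadder_of_stable {T : L.Theory} (hst : IsStableTheory.{u, v, w} T) (N : Type w)
    [L.Structure N] [Nonempty N] (hN : N ⊨ T) : NoLadder L N := by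
  intro α β θ
  by_contra hcon
  push Not at hcon
  obtain ⟨nx, ny, θ', pp, qq, hθ⟩ := exists_fin θ
  choose c y hcy1 hcy using hcon
  apply hst
  let Q := ((hyperfilter ℕ : Ultrafilter ℕ) : Filter ℕ).Product (fun _ => N)
  have hQ : Q ⊨ T := by
    refine ⟨fun φ hφ => ?_⟩
    rw [Ultraproduct.sentence_realize]
    exact Eventually.of_forall fun _ => hN.realize_of_mem φ hφ
  haveI : Nonempty Q := ⟨((fun _ => Classical.arbitrary N : ℕ → N) : Q)⟩
  refine ⟨nx, ny, θ', Theory.ModelType.of T Q,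
    fun i x => ((fun n => c n (i + 1) (pp x) : ℕ → N) : Q),
    fun j x => ((fun n => y n j (qq x) : ℕ → N) : Q), fun i j => ?_⟩
  have e : (Sum.elim (fun x => ((fun n => c n (i + 1) (pp x) : ℕ → N) : Q))
      (fun x => ((fun n => y n j (qq x) : ℕ → N) : Q))) =
      fun x => ((Sum.elim (fun x n => c n (i + 1) (pp x)) (fun x n => y n j (qq x)) x : ℕ → N) : Q) := by
    funext x; cases x <;> rfl
  have key : θ'.Realize (fun x => ((Sum.elim (fun x n => c n (i + 1) (pp x))
      (fun x n => y n j (qq x)) x : ℕ → N) : Q)) ↔ _ :=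
    Ultraproduct.realize_formula_cast θ' _
  refine (iff_of_eq (congrArg (θ'.Realize (M := Q)) e)).trans (key.trans ?_)
  have e2 : ∀ᶠ n in ((hyperfilter ℕ : Ultrafilter ℕ) : Filter ℕ), max (i+1) j < n := by
    have : ∀ᶠ n in (atTop : Filter ℕ), max (i+1) j < n := eventually_gt_atTop _
    rw [← Nat.cofinite_eq_atTop] at this
    exact hyperfilter_le_cofinite this
  have e3 : ∀ᶠ n in ((hyperfilter ℕ : Ultrafilter ℕ) : Filter ℕ),
      ((θ'.Realize fun x => Sum.elim (fun x n => c n (i + 1) (pp x)) (fun x n => y n j (qq x)) x n) ↔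
        i < j) := by
    filter_upwards [e2] with n hn
    have h1 := hcy n (i+1) (by omega) j (by omega)
    simp only [← hθ] at h1
    refine Iff.trans (iff_of_eq (congrArg _ ?_)) (h1.trans (by omega))
    funext x; cases x <;> rfl
  rw [eventually_congr e3]
  simp

theorem ladder_of_limits {ι κ : Type*} (U : Filter ι) (V : Filter κ) [NeBot U] [NeBot V]
    (R : ι → κ → Prop) (h1 : ∀ᶠ i in U, ∀ᶠ j in V, R i j)
    (h2 : ∀ᶠ j in V, ∀ᶠ i in U, ¬ R i j) (p : ℕ) :
    Ladder R (fun l k => l ≤ k) p {i | ∀ᶠ j in V, R i j} {j | ∀ᶠ i in U, ¬ R i j} := by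
  induction p with
  | zero =>
    obtain ⟨i, _⟩ := h1.exists
    obtain ⟨j, _⟩ := h2.exists
    exact ⟨fun _ => i, fun _ => j, by simp, by simp⟩
  | succ n ih =>
    obtain ⟨c, y, hm, hR⟩ := ih
    have a1 : ∀ᶠ i in U, ∀ k ∈ Finset.range n, ¬ R i (y k) := by
      rw [Filter.eventually_all_finset]
      exact fun k hk => (hm k (Finset.mem_range.1 hk)).2
    obtain ⟨i, hi, hi2⟩ := (h1.and a1).exists
    have a2 : ∀ᶠ j in V, ∀ k ∈ Finset.range n, R (c k) j := by
      rw [Filter.eventually_all_finset]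
      exact fun k hk => (hm k (Finset.mem_range.1 hk)).1
    obtain ⟨j, hj, hj2, hj3⟩ := (h2.and (a2.and hi)).exists
    refine ⟨Function.update c n i, Function.update y n j, fun l hl => ?_, fun l hl k hk => ?_⟩
    · rcases Nat.lt_succ_iff_lt_or_eq.1 hl with h | rfl
      · simpa [Function.update_of_ne h.ne] using hm l h
      · simpa using ⟨hi, hj⟩
    · rcases Nat.lt_succ_iff_lt_or_eq.1 hl with h | rfl
      · rcases Nat.lt_succ_iff_lt_or_eq.1 hk with h' | rfl
        · simpa [Function.update_of_ne h.ne, Function.update_of_ne h'.ne] using hR l h k h'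
        · simpa [Function.update_of_ne h.ne, h.le] using hj2 l (by simpa using h)
      · rcases Nat.lt_succ_iff_lt_or_eq.1 hk with h' | rfl
        · simpa [Function.update_of_ne h'.ne, h', Nat.not_le.2 h'] using hi2 k (by simpa using h')
        · simpa using hj3

theorem double_limit {N : Type w} [L.Structure N] (hN : NoLadder L N) {α β : Type w}
    (θ : L.Formula (α ⊕ β)) {ι κ : Type*} (U : Ultrafilter ι) (V : Ultrafilter κ)
    (f : ι → α → N) (g : κ → β → N) :
    (∀ᶠ i in (U : Filter ι), ∀ᶠ j in (V : Filter κ), θ.Realize (Sum.elim (f i) (g j))) ↔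
    (∀ᶠ j in (V : Filter κ), ∀ᶠ i in (U : Filter ι), θ.Realize (Sum.elim (f i) (g j))) := by
  have main : ∀ θ : L.Formula (α ⊕ β),
      (∀ᶠ i in (U : Filter ι), ∀ᶠ j in (V : Filter κ), θ.Realize (Sum.elim (f i) (g j))) →
      (∀ᶠ j in (V : Filter κ), ∀ᶠ i in (U : Filter ι), θ.Realize (Sum.elim (f i) (g j))) := by
    intro θ h1
    by_contra h2
    rw [← Ultrafilter.eventually_not] at h2
    simp only [← Ultrafilter.eventually_not] at h2
    obtain ⟨p, hp⟩ := hN α β θ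
    obtain ⟨c, y, -, h⟩ := ladder_of_limits _ _ _ h1 h2 p
    exact hp ⟨fun l => f (c l), fun l => g (y l), by simp, h⟩
  refine ⟨main θ, fun h => ?_⟩
  by_contra h2
  rw [← Ultrafilter.eventually_not] at h2
  simp only [← Ultrafilter.eventually_not] at h2
  have h3 := main θ.not (by simpa using h2)
  obtain ⟨j, hj, hj'⟩ := (h3.and h).exists
  obtain ⟨i, hi, hi'⟩ := (hj.and hj').exists
  exact (Formula.realize_not.1 hi) hi'

theorem tree_formula (N : Type w) [L.Structure N] [Nonempty N] {α β : Type w}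
    (θ : L.Formula (α ⊕ β)) (n : ℕ) : ∀ {γ : Type w} (ψ : L.Formula (γ ⊕ β)),
    ∃ ρ : L.Formula γ, ∀ v : γ → N, ρ.Realize v ↔
      Tree (fun (c : α → N) (y : β → N) => θ.Realize (Sum.elim c y)) n Set.univ
        {y | ψ.Realize (Sum.elim v y)} := by
  induction n with
  | zero =>
    intro γ ψ
    obtain ⟨ρ, hρ⟩ := exists_ex (ψ.relabel Sum.swap : L.Formula (β ⊕ γ))
    refine ⟨ρ, fun v => (hρ N v).trans ?_⟩
    simp only [Formula.realize_relabel, Tree]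
    refine exists_congr fun y => iff_of_eq (congrArg _ ?_)
    funext x; cases x <;> rfl
  | succ n ih =>
    intro γ ψ
    let i1 : γ ⊕ β → (α ⊕ γ) ⊕ β := Sum.map Sum.inr id
    let i2 : α ⊕ β → (α ⊕ γ) ⊕ β := Sum.map Sum.inl id
    obtain ⟨ρ1, h1⟩ := ih (ψ.relabel i1 ⊓ θ.relabel i2)
    obtain ⟨ρ2, h2⟩ := ih (ψ.relabel i1 ⊓ (θ.relabel i2).not)
    obtain ⟨ρ, hρ⟩ := exists_ex (ρ1 ⊓ ρ2)
    refine ⟨ρ, fun v => (hρ N v).trans ?_⟩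
    have e1 : ∀ (c : α → N) (y : β → N), Sum.elim (Sum.elim c v) y ∘ i1 = Sum.elim v y := by
      intro c y; funext x; cases x <;> rfl
    have e2 : ∀ (c : α → N) (y : β → N), Sum.elim (Sum.elim c v) y ∘ i2 = Sum.elim c y := by
      intro c y; funext x; cases x <;> rfl
    simp only [Formula.realize_inf, h1, h2, Formula.realize_not, Formula.realize_relabel, e1, e2,
      Tree, Set.mem_univ, true_and, Set.mem_ofPred_eq]

/-- Definability of types, in ultrapower form. -/
theorem definability {N : Type w} [L.Structure N] [Nonempty N] (hN : NoLadder L N) {J : Type*}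
    (𝒰 : Ultrafilter J) {α β : Type w} (θ : L.Formula (α ⊕ β)) (y : J → β → N)
    (A : α → Set (J → N)) :
    ∃ (γ : Type w) (s : γ → α) (m : γ → J → N) (D : L.Formula (α ⊕ γ)), (∀ g, m g ∈ A (s g)) ∧
      ∀ c : α → J → N, (∀ a, c a ∈ A a) →
        ((∀ᶠ j in (𝒰 : Filter J), θ.Realize (Sum.elim (fun a => c a j) (y j))) ↔
          ∀ᶠ j in (𝒰 : Filter J), D.Realize (Sum.elim (fun a => c a j) (fun g => m g j))) := by
  classical
  let R : (α → N) → (β → N) → Prop := fun c y => θ.Realize (Sum.elim c y)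
  let S : ℕ → Prop := fun n => ∃ (γ : Type w) (s : γ → α) (m : γ → J → N) (ψ : L.Formula (γ ⊕ β)),
    (∀ g, m g ∈ A (s g)) ∧
    (∀ᶠ j in (𝒰 : Filter J), ψ.Realize (Sum.elim (fun g => m g j) (y j))) ∧
    ¬ ∀ᶠ j in (𝒰 : Filter J), Tree R n Set.univ {y | ψ.Realize (Sum.elim (fun g => m g j) y)}
  have hS : ∃ n, S n := by
    obtain ⟨p, hp⟩ := hN α β θ
    obtain ⟨h, hh⟩ := exists_not_tree hp
    refine ⟨h, PEmpty, fun x => x.elim, fun x => x.elim, ⊤, fun x => x.elim, by simp, fun hc => ?_⟩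
    obtain ⟨j, hj⟩ := hc.exists
    exact hh (Tree.mono subset_rfl (Set.subset_univ _) hj)
  obtain ⟨γ, s, m, ψ, hm, hy, ht⟩ := Nat.find_spec hS
  rcases hn : Nat.find hS with - | n
  · exfalso
    rw [hn] at ht
    refine ht ?_
    filter_upwards [hy] with j hj
    exact ⟨y j, hj⟩
  rw [hn] at ht
  have hmin : ¬ S n := Nat.find_min hS (by omega)
  let i1 : γ ⊕ β → (α ⊕ γ) ⊕ β := Sum.map Sum.inr id
  let i2 : α ⊕ β → (α ⊕ γ) ⊕ β := Sum.map Sum.inl id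
  have e1 : ∀ (c : α → N) (v : γ → N) (y : β → N), Sum.elim (Sum.elim c v) y ∘ i1 = Sum.elim v y := by
    intro c v y; funext x; cases x <;> rfl
  have e2 : ∀ (c : α → N) (v : γ → N) (y : β → N), Sum.elim (Sum.elim c v) y ∘ i2 = Sum.elim c y := by
    intro c v y; funext x; cases x <;> rfl
  have e3 : ∀ (c : α → J → N) (j : J), (fun g => Sum.elim c m g j) =
      Sum.elim (fun a => c a j) (fun g => m g j) := by
    intro c j; funext x; cases x <;> rfl
  obtain ⟨D, hD⟩ := tree_formula N θ n (ψ.relabel i1 ⊓ θ.relabel i2)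
  simp only [Formula.realize_inf, Formula.realize_relabel] at hD
  refine ⟨γ, s, m, D, hm, fun c hc => ?_⟩
  simp only [hD, e1, e2]
  have hmem : ∀ g, Sum.elim c m g ∈ A (Sum.elim id s g) := by
    rintro (a | g)
    · exact hc a
    · exact hm g
  constructor
  · intro h
    by_contra hcon
    refine hmin ⟨α ⊕ γ, Sum.elim id s, Sum.elim c m, ψ.relabel i1 ⊓ θ.relabel i2, hmem, ?_, ?_⟩
    · simp only [e3, Formula.realize_inf, Formula.realize_relabel, e1, e2]
      exact hy.and h
    · simpa only [e3, Formula.realize_inf, Formula.realize_relabel, e1, e2] using hcon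
  · intro h
    by_contra hcon
    rw [← Ultrafilter.eventually_not] at hcon
    refine hmin ⟨α ⊕ γ, Sum.elim id s, Sum.elim c m, ψ.relabel i1 ⊓ (θ.relabel i2).not, hmem, ?_, ?_⟩
    · simp only [e3, Formula.realize_inf, Formula.realize_not, Formula.realize_relabel, e1, e2]
      exact hy.and hcon
    · simp only [e3, Formula.realize_inf, Formula.realize_not, Formula.realize_relabel, e1, e2]
      intro h'
      refine ht ?_
      filter_upwards [h, h'] with j hj hj'
      exact ⟨fun a => c a j, Set.mem_univ _, hj, hj'⟩

end Stability

section Amalgam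

open Filter

variable {L : Language.{u, v}}

/-- Tensor product of ultrafilters. -/
noncomputable def tens {α β : Type*} (U : Ultrafilter α) (V : Ultrafilter β) :
    Ultrafilter (α × β) :=
  Ultrafilter.ofComplNotMemIff
    ((U : Filter α).bind fun a => (V : Filter β).map (Prod.mk a)) (by
      intro s
      have h : ∀ s : Set (α × β), s ∈ ((U : Filter α).bind fun a => (V : Filter β).map (Prod.mk a)) ↔
          ∀ᶠ a in U, ∀ᶠ b in V, (a, b) ∈ s := fun s => Iff.rfl
      rw [h, h, ← Ultrafilter.eventually_not]
      simp only [← Ultrafilter.eventually_not, Set.mem_compl_iff, not_not])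

theorem eventually_tens {α β : Type*} (U : Ultrafilter α) (V : Ultrafilter β) (q : α × β → Prop) :
    (∀ᶠ j in tens U V, q j) ↔ ∀ᶠ a in U, ∀ᶠ b in V, q (a, b) := Iff.rfl

theorem eventually_uiff {α : Type*} (U : Ultrafilter α) (q r : α → Prop) :
    (∀ᶠ j in U, (q j ↔ r j)) ↔ ((∀ᶠ j in U, q j) ↔ ∀ᶠ j in U, r j) := by
  simp only [iff_iff_implies_and_implies, eventually_and, Ultrafilter.eventually_imp]

theorem ev_congr {N : Type w} [L.Structure N] [Nonempty N] {K : Type*} (W : Ultrafilter K)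
    {α : Type w} (θ : L.Formula α) (c c' : α → K → N) (h : ∀ a, ∀ᶠ k in W, c a k = c' a k) :
    (∀ᶠ k in W, θ.Realize (fun a => c a k)) ↔ (∀ᶠ k in W, θ.Realize (fun a => c' a k)) := by
  rw [← Ultraproduct.realize_formula_cast (M := fun _ => N) θ c,
    ← Ultraproduct.realize_formula_cast (M := fun _ => N) θ c']
  refine iff_of_eq (congrArg _ ?_)
  funext a
  exact Quotient.sound (h a)

/-- The index type of the amalgam. -/
abbrev AmI (N : Type w) : Type w := ℕ × ((ℕ × ℕ → N) → ℕ → N)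

/-- The crucial property of the ultrafilter used in the amalgam. -/
structure IsAmal (L : Language.{u, v}) {N : Type w} [L.Structure N] (U : Ultrafilter ℕ)
    (V : Ultrafilter (ℕ × ((ℕ × ℕ → N) → ℕ → N))) : Prop where
  v1 : ∀ χ : L.Formula ((ℕ × ℕ → N) ⊕ ((ℕ → N) ⊕ (ℕ → N))),
    (∀ᶠ i2 in U, ∀ᶠ i0 in U, χ.Realize
      (Sum.elim (fun z => z (i2, i0)) (Sum.elim (fun a => a i0) (fun a => a i2)))) →
    ∀ᶠ p : AmI N in V, ∀ᶠ i2 in U, χ.Realize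
      (Sum.elim (fun z => p.2 z i2) (Sum.elim (fun a => a p.1) (fun a => a i2)))
  v4 : ∀ S ∈ U, ∀ᶠ p : AmI N in V, p.1 ∈ S

theorem IsAmal.v1_iff {N : Type w} [L.Structure N] {U : Ultrafilter ℕ}
    {V : Ultrafilter (ℕ × ((ℕ × ℕ → N) → ℕ → N))} (hV : IsAmal L U V)
    (χ : L.Formula ((ℕ × ℕ → N) ⊕ ((ℕ → N) ⊕ (ℕ → N)))) :
    (∀ᶠ p : AmI N in V, ∀ᶠ i2 in U, χ.Realize
      (Sum.elim (fun z => p.2 z i2) (Sum.elim (fun a => a p.1) (fun a => a i2)))) ↔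
    (∀ᶠ i2 in U, ∀ᶠ i0 in U, χ.Realize
      (Sum.elim (fun z => z (i2, i0)) (Sum.elim (fun a => a i0) (fun a => a i2)))) := by
  refine ⟨fun h => ?_, hV.v1 χ⟩
  by_contra hc
  rw [← Ultrafilter.eventually_not] at hc
  simp only [← Ultrafilter.eventually_not] at hc
  have h3 := hV.v1 χ.not (by simpa using hc)
  obtain ⟨j, hj, hj'⟩ := (h3.and h).exists
  obtain ⟨i, hi, hi'⟩ := (hj.and hj').exists
  exact (Formula.realize_not.1 hi) hi'

theorem exists_isAmal {N : Type w} [L.Structure N] [Nonempty N] (hN : NoLadder L N)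
    (U : Ultrafilter ℕ) : ∃ V : Ultrafilter (ℕ × ((ℕ × ℕ → N) → ℕ → N)), IsAmal L U V := by
  let hyp : L.Formula ((ℕ × ℕ → N) ⊕ ((ℕ → N) ⊕ (ℕ → N))) → Prop := fun χ =>
    ∀ᶠ i2 in U, ∀ᶠ i0 in U, χ.Realize
      (Sum.elim (fun z => z (i2, i0)) (Sum.elim (fun a => a i0) (fun a => a i2)))
  let X : L.Formula ((ℕ × ℕ → N) ⊕ ((ℕ → N) ⊕ (ℕ → N))) → Set ℕ →
      Set (ℕ × ((ℕ × ℕ → N) → ℕ → N)) := fun χ S =>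
    {p | p.1 ∈ S ∧ ∀ᶠ i2 in U, χ.Realize
      (Sum.elim (fun z => p.2 z i2) (Sum.elim (fun a => a p.1) (fun a => a i2)))}
  let 𝓕 : Filter (ℕ × ((ℕ × ℕ → N) → ℕ → N)) :=
    { sets := {s | ∃ χ S, hyp χ ∧ S ∈ U ∧ X χ S ⊆ s}
      univ_sets := ⟨⊤, Set.univ, by simp [hyp], univ_mem, Set.subset_univ _⟩
      sets_of_superset := by
        rintro s t ⟨χ, S, h1, h2, h3⟩ hst
        exact ⟨χ, S, h1, h2, h3.trans hst⟩
      inter_sets := by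
        rintro s t ⟨χ, S, h1, h2, h3⟩ ⟨χ', S', h1', h2', h3'⟩
        refine ⟨χ ⊓ χ', S ∩ S', ?_, inter_mem h2 h2', ?_⟩
        · simp only [hyp, Formula.realize_inf, eventually_and]
          exact ⟨h1, h1'⟩
        · intro p hp
          simp only [X, Formula.realize_inf, eventually_and] at hp
          exact ⟨h3 ⟨hp.1.1, hp.2.1⟩, h3' ⟨hp.1.2, hp.2.2⟩⟩ }
  have hne : NeBot 𝓕 := by
    rw [← forall_mem_nonempty_iff_neBot]
    rintro s ⟨χ, S, h1, h2, h3⟩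
    refine Set.Nonempty.mono h3 ?_
    obtain ⟨ψ, hψ⟩ := exists_ex χ
    have a1 : ∀ᶠ i2 in U, ∀ᶠ i0 in U, ψ.Realize
        (Sum.elim (fun a : ℕ → N => a i0) (fun a : ℕ → N => a i2)) := by
      filter_upwards [h1] with i2 hi2
      filter_upwards [hi2] with i0 hi0
      exact (hψ N _).2 ⟨_, hi0⟩
    rw [← double_limit hN ψ U U (fun i0 a => a i0) (fun i2 a => a i2)] at a1
    obtain ⟨i, hi, hiS⟩ := (a1.and h2).exists
    have a2 : ∀ i2, ∃ u : (ℕ × ℕ → N) → N, ψ.Realize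
        (Sum.elim (fun a : ℕ → N => a i) (fun a : ℕ → N => a i2)) →
        χ.Realize (Sum.elim u (Sum.elim (fun a : ℕ → N => a i) (fun a : ℕ → N => a i2))) := by
      intro i2
      by_cases h : ψ.Realize (Sum.elim (fun a : ℕ → N => a i) (fun a : ℕ → N => a i2))
      · obtain ⟨u, hu⟩ := (hψ N _).1 h
        exact ⟨u, fun _ => hu⟩
      · exact ⟨fun _ => Classical.arbitrary N, fun h' => (h h').elim⟩
    choose t ht using a2
    refine ⟨(i, fun z i2 => t i2 z), hiS, ?_⟩
    filter_upwards [hi] with i2 hi2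
    exact ht i2 hi2
  have hle : ((Ultrafilter.of 𝓕 : Ultrafilter _) : Filter _) ≤ 𝓕 := Ultrafilter.of_le 𝓕
  refine ⟨Ultrafilter.of 𝓕, ⟨fun χ h => hle ⟨χ, Set.univ, h, univ_mem, fun p hp => hp.2⟩,
    fun S hS => hle ⟨⊤, S, by simp [hyp], hS, fun p hp => hp.1⟩⟩⟩

variable {N : Type w} [L.Structure N] [Nonempty N]

/-- Truth of a formula about `x(i0,i1)` and `z(i2,i0)` in the amalgam. -/
def PairTr (U : Ultrafilter ℕ) (V : Ultrafilter (ℕ × ((ℕ × ℕ → N) → ℕ → N)))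
    {α β : Type w} (θ : L.Formula (α ⊕ β)) (x : α → ℕ × ℕ → N) (z : β → ℕ × ℕ → N) : Prop :=
  ∀ᶠ k : AmI N × (ℕ × ℕ) in tens V (tens U U), θ.Realize
    (Sum.elim (fun a => x a (k.1.1, k.2.1)) (fun b => k.1.2 (z b) k.2.2))

theorem realize_equiv_comp (τ : N ≃[L] N) {α : Type*} (θ : L.Formula α) (v : α → N) :
    θ.Realize (fun a => τ (v a)) ↔ θ.Realize v := by
  have := StrongHomClass.realize_formula τ θ (v := v)
  exact this

theorem pair_def (hN : NoLadder L N) (U : Ultrafilter ℕ)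
    (V : Ultrafilter (ℕ × ((ℕ × ℕ → N) → ℕ → N))) (hV : IsAmal L U V)
    {α β : Type w} (θ : L.Formula (α ⊕ β)) (x : α → ℕ × ℕ → N) :
    ∃ (γ : Type w) (m : γ → ℕ → N) (D : L.Formula (β ⊕ γ)),
      ∀ (τ : N ≃[L] N) (z : β → ℕ × ℕ → N), PairTr U V θ (fun a j => τ (x a j)) z ↔
        ∀ᶠ i2 in U, ∀ᶠ i0 in U, D.Realize (Sum.elim (fun b => z b (i2, i0)) (fun g => τ (m g i0))) := by
  obtain ⟨γ, s, m', D, hm', hD⟩ := definability hN (tens U U)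
    (θ.relabel Sum.swap : L.Formula (β ⊕ α)) (fun j a => x a j)
    (fun _ => {c | ∃ d : ℕ → N, c = fun j => d j.1})
  choose m hm using hm'
  refine ⟨γ, m, D, fun τ z => ?_⟩
  have e1 : ∀ (c : β → N) (d : α → N), Sum.elim c d ∘ Sum.swap = Sum.elim d c := by
    intro c d; funext x; cases x <;> rfl
  simp only [Formula.realize_relabel, e1, hm, eventually_tens, eventually_const] at hD
  have claim : ∀ᶠ i in U, ∀ c : β → N, (∀ᶠ i1 in U, θ.Realize (Sum.elim (fun a => x a (i, i1)) c)) ↔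
      D.Realize (Sum.elim c (fun g => m g i)) := by
    by_contra hcon
    rw [← Ultrafilter.eventually_not] at hcon
    have : ∀ i, ∃ c : β → N, (¬ ∀ c : β → N, (∀ᶠ i1 in U, θ.Realize (Sum.elim (fun a => x a (i, i1)) c)) ↔
      D.Realize (Sum.elim c (fun g => m g i))) →
      ¬ ((∀ᶠ i1 in U, θ.Realize (Sum.elim (fun a => x a (i, i1)) c)) ↔
      D.Realize (Sum.elim c (fun g => m g i))) := by
      intro i
      by_cases h : ∀ c : β → N, (∀ᶠ i1 in U, θ.Realize (Sum.elim (fun a => x a (i, i1)) c)) ↔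
        D.Realize (Sum.elim c (fun g => m g i))
      · exact ⟨fun _ => Classical.arbitrary N, fun h' => (h' h).elim⟩
      · obtain ⟨c, hc⟩ := not_forall.1 h
        exact ⟨c, fun _ => hc⟩
    choose c hc using this
    have h1 := hD (fun b j => c j.1 b) (fun b => ⟨fun i => c i b, rfl⟩)
    simp only [eventually_const] at h1
    rw [← eventually_uiff] at h1
    obtain ⟨i, hi, hi'⟩ := (hcon.and h1).exists
    exact hc i hi hi'
  have claim2 : ∀ᶠ i in U, ∀ c : β → N,
      (∀ᶠ i1 in U, θ.Realize (Sum.elim (fun a => τ (x a (i, i1))) c)) ↔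
      D.Realize (Sum.elim c (fun g => τ (m g i))) := by
    filter_upwards [claim] with i hi c
    have h := hi (fun b => τ.symm (c b))
    rw [← realize_equiv_comp τ D] at h
    have h' : ∀ i1, θ.Realize (Sum.elim (fun a => x a (i, i1)) (fun b => τ.symm (c b))) ↔ _ := fun i1 =>
      (realize_equiv_comp τ θ _).symm
    simp only [h'] at h
    have e2 : ∀ (γ' : Type w) (d : γ' → N), (fun q => τ (Sum.elim d (fun b => τ.symm (c b)) q)) =
        Sum.elim (fun a => τ (d a)) c := by
      intro γ' d; funext q; cases q <;> simp
    have e3 : ∀ (γ' : Type w) (d : γ' → N), (fun q => τ (Sum.elim (fun b => τ.symm (c b)) d q)) =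
        Sum.elim c (fun a => τ (d a)) := by
      intro γ' d; funext q; cases q <;> simp
    simpa only [e2, e3] using h
  simp only [PairTr, eventually_tens]
  have s1 : (∀ᶠ p : AmI N in V, ∀ᶠ i1 in U, ∀ᶠ i2 in U, θ.Realize
      (Sum.elim (fun a => τ (x a (p.1, i1))) (fun b => p.2 (z b) i2))) ↔
      ∀ᶠ p : AmI N in V, ∀ᶠ i2 in U, D.Realize (Sum.elim (fun b => p.2 (z b) i2) (fun g => τ (m g p.1))) := by
    refine eventually_congr ?_
    filter_upwards [hV.v4 _ claim2] with p hp
    rw [double_limit hN θ U U (fun i1 a => τ (x a (p.1, i1))) (fun i2 b => p.2 (z b) i2)]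
    refine eventually_congr (Eventually.of_forall fun i2 => ?_)
    exact hp _
  rw [s1]
  have s2 := hV.v1_iff (D.relabel (Sum.elim (fun b => Sum.inl (z b))
    (fun g => Sum.inr (Sum.inl (fun i => τ (m g i))))))
  simp only [Formula.realize_relabel] at s2
  have e4 : ∀ (f : (ℕ × ℕ → N) → N) (g h : (ℕ → N) → N),
      Sum.elim f (Sum.elim g h) ∘ (Sum.elim (fun b => Sum.inl (z b))
        (fun g => Sum.inr (Sum.inl (fun i => τ (m g i))))) =
      Sum.elim (fun b => f (z b)) (fun q => g (fun i => τ (m q i))) := by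
    intro f g h; funext q; cases q <;> rfl
  simpa only [e4] using s2

theorem pair_inv (hN : NoLadder L N) (U : Ultrafilter ℕ)
    (V : Ultrafilter (ℕ × ((ℕ × ℕ → N) → ℕ → N))) (hV : IsAmal L U V) (σ : N ≃[L] N)
    {α β : Type w} (θ : L.Formula (α ⊕ β)) (x : α → ℕ × ℕ → N) (z : β → ℕ × ℕ → N) :
    PairTr U V θ (fun a j => σ (x a j)) (fun b j => σ (z b j)) ↔ PairTr U V θ x z := by
  obtain ⟨γ, m, D, h⟩ := pair_def (β := β) hN U V hV θ x
  have h1 := h (FirstOrder.Language.Equiv.refl L N) z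
  simp only [FirstOrder.Language.Equiv.refl_apply] at h1
  rw [h1, h]
  refine eventually_congr (Eventually.of_forall fun i2 => ?_)
  refine eventually_congr (Eventually.of_forall fun i0 => ?_)
  refine Iff.trans ?_ (realize_equiv_comp σ D _)
  refine iff_of_eq (congrArg _ ?_)
  funext q; cases q <;> rfl

/-- Truth of a formula about `x(i0,i1)`, `z(i2,i0)` and `y(i1,i2)` in the amalgam. -/
def TripTr (U : Ultrafilter ℕ) (V : Ultrafilter (ℕ × ((ℕ × ℕ → N) → ℕ → N)))
    {α β δ : Type w} (θ : L.Formula ((α ⊕ β) ⊕ δ)) (x : α → ℕ × ℕ → N) (z : β → ℕ × ℕ → N)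
    (y : δ → ℕ × ℕ → N) : Prop :=
  ∀ᶠ k : AmI N × (ℕ × ℕ) in tens V (tens U U), θ.Realize
    (Sum.elim (Sum.elim (fun a => x a (k.1.1, k.2.1)) (fun b => k.1.2 (z b) k.2.2))
      (fun d => y d k.2))

theorem IsAmal.fst {U : Ultrafilter ℕ} {V : Ultrafilter (ℕ × ((ℕ × ℕ → N) → ℕ → N))}
    (hV : IsAmal L U V) (d : ℕ → N) : ∀ᶠ p : AmI N in V, ∀ᶠ i2 in U, p.2 (fun j => d j.1) i2 = d i2 := by
  have := (hV.v1_iff (Term.equal (Term.var (Sum.inl fun j => d j.1))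
    (Term.var (Sum.inr (Sum.inr d))))).2 (by simp [Formula.realize_equal])
  simpa [Formula.realize_equal] using this

theorem IsAmal.snd {U : Ultrafilter ℕ} {V : Ultrafilter (ℕ × ((ℕ × ℕ → N) → ℕ → N))}
    (hV : IsAmal L U V) (d : ℕ → N) : ∀ᶠ p : AmI N in V, ∀ᶠ i2 in U, p.2 (fun j => d j.2) i2 = d p.1 := by
  have := (hV.v1_iff (Term.equal (Term.var (Sum.inl fun j => d j.2))
    (Term.var (Sum.inr (Sum.inl d))))).2 (by simp [Formula.realize_equal])
  simpa [Formula.realize_equal] using this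

theorem trip_def (hN : NoLadder L N) (U : Ultrafilter ℕ)
    (V : Ultrafilter (ℕ × ((ℕ × ℕ → N) → ℕ → N))) (hV : IsAmal L U V)
    {α β δ : Type w} (θ : L.Formula ((α ⊕ β) ⊕ δ)) (y : δ → ℕ × ℕ → N) :
    ∃ (γ : Type w) (d : γ → ℕ → N) (D : L.Formula ((α ⊕ γ) ⊕ (β ⊕ γ))),
      ∀ (τ : N ≃[L] N) (x : α → ℕ × ℕ → N) (z : β → ℕ × ℕ → N),
        TripTr U V θ x z (fun a j => τ (y a j)) ↔
          PairTr U V D (Sum.elim x (fun g j => τ (d g j.2))) (Sum.elim z (fun g j => τ (d g j.1))) := by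
  obtain ⟨γ, s, m, D, hm, hD⟩ := definability hN (tens U U) θ (fun j a => y a j)
    (Sum.elim (fun _ => {c | ∃ d : ℕ → N, c = fun j => d j.1})
      (fun _ => {c | ∃ d : ℕ → N, c = fun j => d j.2}))
  have hd : ∀ g, ∃ d : ℕ → N, m g = Sum.elim (fun (_ : α) j => d j.1) (fun (_ : β) j => d j.2) (s g) := by
    intro g
    have := hm g
    revert this
    rcases s g with a | b
    · exact id
    · exact id
  choose d hd using hd
  let r : (α ⊕ β) ⊕ γ → (α ⊕ γ) ⊕ (β ⊕ γ) := Sum.elim (Sum.map Sum.inl Sum.inl)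
    (fun g => Sum.elim (fun _ => Sum.inl (Sum.inr g)) (fun _ => Sum.inr (Sum.inr g)) (s g))
  refine ⟨γ, d, D.relabel r, fun τ x z => ?_⟩
  -- step one: definability
  have s1 : TripTr U V θ x z (fun a j => τ (y a j)) ↔ ∀ᶠ k : AmI N × (ℕ × ℕ) in tens V (tens U U), D.Realize
      (Sum.elim (Sum.elim (fun a => x a (k.1.1, k.2.1)) (fun b => k.1.2 (z b) k.2.2))
        (fun g => τ (m g k.2))) := by
    rw [TripTr, eventually_tens, eventually_tens]
    refine eventually_congr (Eventually.of_forall fun p => ?_)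
    have h := hD (Sum.elim (fun a j => τ.symm (x a (p.1, j.1))) (fun b j => τ.symm (p.2 (z b) j.2))) (by
      rintro (a | b)
      · exact ⟨fun i => τ.symm (x a (p.1, i)), rfl⟩
      · exact ⟨fun i => τ.symm (p.2 (z b) i), rfl⟩)
    rw [eventually_congr (Eventually.of_forall fun j => (realize_equiv_comp τ D _).symm),
      eventually_congr (Eventually.of_forall fun j => (realize_equiv_comp τ θ _).symm)] at h
    have e : ∀ (γ' : Type w) (j : ℕ × ℕ) (d : γ' → N), (fun q => τ (Sum.elim (fun a => (Sum.elim
        (fun a (j : ℕ × ℕ) => τ.symm (x a (p.1, j.1))) (fun b j => τ.symm (p.2 (z b) j.2)) a j)) d q)) =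
        Sum.elim (Sum.elim (fun a => x a (p.1, j.1)) (fun b => p.2 (z b) j.2)) (fun a => τ (d a)) := by
      intro γ' j d; funext q; rcases q with (q | q) | q <;> simp
    simpa only [e] using h
  rw [s1, PairTr]
  simp only [Formula.realize_relabel]
  have h := ev_congr (tens V (tens U U)) D (Sum.elim (Sum.elim
    (fun a k => x a (k.1.1, k.2.1)) (fun b k => k.1.2 (z b) k.2.2)) (fun g k => τ (m g k.2)))
    (fun q k => (Sum.elim (fun a => Sum.elim x (fun g j => τ (d g j.2)) a (k.1.1, k.2.1))
      (fun b => k.1.2 (Sum.elim z (fun g j => τ (d g j.1)) b) k.2.2) ∘ r) q) ?_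
  rotate_left
  · rintro ((a | b) | g)
    · exact Eventually.of_forall fun k => rfl
    · exact Eventually.of_forall fun k => rfl
    · have := hd g
      rcases hs : s g with a | b
      · rw [hs] at this
        refine Eventually.of_forall fun k => ?_
        simp [this, r, hs]
      · rw [hs] at this
        have h := hV.fst (fun i => τ (d g i))
        simp only [eventually_tens]
        filter_upwards [h] with p hp
        refine Eventually.of_forall fun i1 => ?_
        filter_upwards [hp] with i2 hi2
        simp [this, r, hs, hi2]
  refine Iff.trans (iff_of_eq ?_) h
  congr 1
  funext k
  congr 1
  funext q; rcases q with (q | q) | q <;> rfl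

theorem trip_inv (hN : NoLadder L N) (U : Ultrafilter ℕ)
    (V : Ultrafilter (ℕ × ((ℕ × ℕ → N) → ℕ → N))) (hV : IsAmal L U V) (σ : N ≃[L] N)
    {α β δ : Type w} (θ : L.Formula ((α ⊕ β) ⊕ δ)) (x : α → ℕ × ℕ → N) (z : β → ℕ × ℕ → N)
    (y : δ → ℕ × ℕ → N) :
    TripTr U V θ (fun a j => σ (x a j)) (fun b j => σ (z b j)) (fun b j => σ (y b j)) ↔
      TripTr U V θ x z y := by
  obtain ⟨γ, d, D, h⟩ := trip_def (α := α) (β := β) hN U V hV θ y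
  have h1 := h (FirstOrder.Language.Equiv.refl L N) x z
  simp only [FirstOrder.Language.Equiv.refl_apply] at h1
  rw [h1, h]
  refine Iff.trans (iff_of_eq ?_) (pair_inv hN U V hV σ D _ _)
  congr 1
  · funext q; cases q <;> rfl
  · funext q; cases q <;> rfl

/-- The amalgam of three copies of an ultrapower around a triangle. -/
theorem exists_amalgam (hN : NoLadder L N) (U : Ultrafilter ℕ) (σ : N ≃[L] N) :
    ∃ (P : Type w) (_ : L.Structure P) (_ : Nonempty P) (e01 e12 e20 : (ℕ × ℕ → N) → P),
      (∀ φ : L.Sentence, P ⊨ φ ↔ N ⊨ φ) ∧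
      (∀ θ : L.Formula (ℕ × ℕ → N), θ.Realize e01 ↔ ∀ᶠ j in tens U U, θ.Realize (fun x => x j)) ∧
      (∀ θ : L.Formula (ℕ × ℕ → N), θ.Realize e12 ↔ ∀ᶠ j in tens U U, θ.Realize (fun x => x j)) ∧
      (∀ θ : L.Formula (ℕ × ℕ → N), θ.Realize e20 ↔ ∀ᶠ j in tens U U, θ.Realize (fun x => x j)) ∧
      (∀ d : ℕ → N, e01 (fun j => d j.1) = e20 (fun j => d j.2)) ∧
      (∀ d : ℕ → N, e01 (fun j => d j.2) = e12 (fun j => d j.1)) ∧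
      (∀ d : ℕ → N, e12 (fun j => d j.2) = e20 (fun j => d j.1)) ∧
      ∀ θ : L.Formula (((ℕ × ℕ → N) ⊕ (ℕ × ℕ → N)) ⊕ (ℕ × ℕ → N)),
        θ.Realize (Sum.elim (Sum.elim e01 e20) e12) ↔
        θ.Realize (Sum.elim (Sum.elim (fun x => e01 fun j => σ (x j)) (fun x => e20 fun j => σ (x j)))
          (fun x => e12 fun j => σ (x j))) := by
  obtain ⟨V, hV⟩ := exists_isAmal hN U
  let K := (ℕ × ((ℕ × ℕ → N) → ℕ → N)) × (ℕ × ℕ)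
  let W : Ultrafilter K := tens V (tens U U)
  let P := (W : Filter K).Product (fun _ => N)
  let mk : (K → N) → P := fun f => (f : P)
  have los : ∀ {α : Type w} (θ : L.Formula α) (c : α → K → N),
      θ.Realize (fun a => mk (c a)) ↔ ∀ᶠ k in W, θ.Realize (fun a => c a k) := fun θ c =>
    Ultraproduct.realize_formula_cast (M := fun _ => N) θ c
  let f01 : (ℕ × ℕ → N) → K → N := fun x k => x (k.1.1, k.2.1)
  let f12 : (ℕ × ℕ → N) → K → N := fun y k => y k.2
  let f20 : (ℕ × ℕ → N) → K → N := fun z k => k.1.2 z k.2.2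
  refine ⟨P, inferInstance, ⟨mk fun _ => Classical.arbitrary N⟩, fun x => mk (f01 x),
    fun x => mk (f12 x), fun x => mk (f20 x), ?_, ?_, ?_, ?_, ?_, ?_, ?_, ?_⟩
  · intro φ
    rw [Ultraproduct.sentence_realize]
    simp
  · intro θ
    rw [los]
    refine ⟨fun h => ?_, fun h => ?_⟩
    · by_contra hc
      rw [← Ultrafilter.eventually_not] at hc
      obtain ⟨p, hp1, hp2⟩ := ((hV.v4 _ hc).and ((eventually_tens V (tens U U) _).1 h)).exists
      obtain ⟨i1, hi1, hi1'⟩ := (Eventually.and hp1 ((eventually_tens U U _).1 hp2)).exists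
      obtain ⟨i2, hi2⟩ := hi1'.exists
      exact hi1 hi2
    · refine (eventually_tens V (tens U U) _).2 ?_
      filter_upwards [hV.v4 _ h] with p hp
      refine (eventually_tens U U _).2 ?_
      filter_upwards [hp] with i1 hi1
      exact Eventually.of_forall fun i2 => hi1
  · intro θ
    rw [los]
    refine (eventually_tens V (tens U U) _).trans ?_
    exact eventually_const (p := ∀ᶠ j in tens U U, θ.Realize (fun x : ℕ × ℕ → N => x j))
  · intro θ
    rw [los]
    have h := hV.v1_iff (θ.relabel Sum.inl)
    simp only [Formula.realize_relabel, Sum.elim_comp_inl] at h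
    refine Iff.trans ?_ h
    rw [eventually_tens]
    refine eventually_congr (Eventually.of_forall fun p => ?_)
    exact eventually_const (p := ∀ᶠ i2 in U, θ.Realize (fun z : ℕ × ℕ → N => p.2 z i2))
  · intro d
    refine Quotient.sound ?_
    change ∀ᶠ k in W, f01 (fun j => d j.1) k = f20 (fun j => d j.2) k
    refine (eventually_tens V (tens U U) _).2 ?_
    filter_upwards [hV.snd d] with p hp
    refine (eventually_tens U U _).2 ?_
    refine Eventually.of_forall fun i1 => ?_
    filter_upwards [hp] with i2 hi2
    exact hi2.symm
  · intro d
    rfl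
  · intro d
    refine Quotient.sound ?_
    change ∀ᶠ k in W, f12 (fun j => d j.2) k = f20 (fun j => d j.1) k
    refine (eventually_tens V (tens U U) _).2 ?_
    filter_upwards [hV.fst d] with p hp
    refine (eventually_tens U U _).2 ?_
    refine Eventually.of_forall fun i1 => ?_
    filter_upwards [hp] with i2 hi2
    exact hi2.symm
  · intro θ
    have key : ∀ g : (ℕ × ℕ → N) → (ℕ × ℕ → N), θ.Realize (Sum.elim (Sum.elim
        (fun x => mk (f01 (g x))) (fun x => mk (f20 (g x)))) (fun x => mk (f12 (g x)))) ↔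
        TripTr U V θ g g g := by
      intro g
      have h := los θ (Sum.elim (Sum.elim (fun x => f01 (g x)) (fun x => f20 (g x)))
        (fun x => f12 (g x)))
      refine Iff.trans (iff_of_eq ?_) (h.trans (iff_of_eq ?_))
      · congr 1
        funext q; rcases q with (q | q) | q <;> rfl
      · unfold TripTr
        congr 1
        funext k
        congr 1
        funext q; rcases q with (q | q) | q <;> rfl
    have k1 := key id
    have k2 := key (fun x j => σ (x j))
    simp only [id] at k1
    rw [k1, k2]
    exact (trip_inv hN U V hV σ θ id id id).symm

end Amalgam

section Extension

open Filter

variable {L : Language.{u, v}}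

theorem exists_step {P : Type w} [L.Structure P] [Nonempty P] {E : Type w} (e e' : E → P)
    (h : ∀ θ : L.Formula E, θ.Realize e ↔ θ.Realize e') :
    ∃ (Q : Type w) (_ : L.Structure Q) (j g : P ↪ₑ[L] Q), ∀ x, g (e x) = j (e' x) := by
  let X : L.Formula (P ⊕ E) → Set (P → P) := fun χ => {u | χ.Realize (Sum.elim u e')}
  let 𝓕 : Filter (P → P) :=
    { sets := {s | ∃ χ : L.Formula (P ⊕ E), χ.Realize (Sum.elim id e) ∧ X χ ⊆ s}
      univ_sets := ⟨⊤, by simp, Set.subset_univ _⟩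
      sets_of_superset := by
        rintro s t ⟨χ, h1, h3⟩ hst
        exact ⟨χ, h1, h3.trans hst⟩
      inter_sets := by
        rintro s t ⟨χ, h1, h3⟩ ⟨χ', h1', h3'⟩
        refine ⟨χ ⊓ χ', Formula.realize_inf.2 ⟨h1, h1'⟩, ?_⟩
        intro p hp
        have hp' := Formula.realize_inf.1 hp
        exact ⟨h3 hp'.1, h3' hp'.2⟩ }
  have hne : NeBot 𝓕 := by
    rw [← forall_mem_nonempty_iff_neBot]
    rintro s ⟨χ, h1, h3⟩
    refine Set.Nonempty.mono h3 ?_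
    obtain ⟨ψ, hψ⟩ := exists_ex χ
    exact (hψ P e').1 ((h ψ).1 ((hψ P e).2 ⟨_, h1⟩))
  let W := Ultrafilter.of 𝓕
  have hle : (W : Filter (P → P)) ≤ 𝓕 := Ultrafilter.of_le 𝓕
  let Q := (W : Filter (P → P)).Product (fun _ => P)
  let mk : ((P → P) → P) → Q := fun f => (f : Q)
  have los : ∀ {α : Type} (θ : L.Formula α) (c : α → (P → P) → P),
      θ.Realize (fun a => mk (c a)) ↔ ∀ᶠ k in W, θ.Realize (fun a => c a k) := fun θ c =>
    Ultraproduct.realize_formula_cast (M := fun _ => P) θ c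
  have hg : ∀ (n : ℕ) (φ : L.Formula (Fin n)) (x : Fin n → P), φ.Realize x →
      ∀ᶠ k : P → P in W, φ.Realize (fun a => k (x a)) := by
    intro n φ x hx
    refine hle ⟨φ.relabel (fun a => Sum.inl (x a)), ?_, ?_⟩
    · rw [Formula.realize_relabel]
      exact hx
    · intro u hu
      have hu' : (φ.relabel (fun a => (Sum.inl (x a) : P ⊕ E))).Realize (Sum.elim u e') := hu
      rw [Formula.realize_relabel] at hu'
      exact hu'
  refine ⟨Q, inferInstance, ⟨fun p => mk fun _ => p, ?_⟩, ⟨fun p => mk fun u => u p, ?_⟩, ?_⟩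
  · intro n φ x
    exact (los φ (fun a _ => x a)).trans eventually_const
  · intro n φ x
    refine (los φ (fun a u => u (x a))).trans ⟨fun hx => ?_, hg n φ x⟩
    by_contra hc
    have := hg n φ.not x (Formula.realize_not.2 hc)
    obtain ⟨k, hk, hk'⟩ := (this.and hx).exists
    exact (Formula.realize_not.1 hk) hk'
  · intro x
    refine Quotient.sound ?_
    refine hle ⟨Term.equal (Term.var (Sum.inl (e x))) (Term.var (Sum.inr x)), ?_, ?_⟩
    · simp [Formula.realize_equal]
    · intro u hu
      have hu' := Formula.realize_equal.1 hu
      exact hu'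

/-- A pair of elementary embeddings between two structures. -/
structure Stage (L : Language.{u, v}) where
  A : Type w
  B : Type w
  sA : L.Structure A
  sB : L.Structure B
  nA : Nonempty A
  j : A ↪ₑ[L] B
  g : A ↪ₑ[L] B

attribute [instance] Stage.sA Stage.sB Stage.nA

theorem Stage.exists_next (S : Stage.{u, v, w} L) :
    ∃ (S' : Stage.{u, v, w} L) (j g : S.B ↪ₑ[L] S'.A), (∀ x, g (S.g x) = j (S.j x)) ∧
      ∀ y, S'.g (g y) = S'.j (j y) := by
  have nB : Nonempty S.B := ⟨S.j (Classical.arbitrary S.A)⟩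
  obtain ⟨C, sC, j1, g1, h1⟩ := exists_step (L := L) (S.g : S.A → S.B) S.j
    (fun θ => (S.g.map_formula θ id).trans (S.j.map_formula θ id).symm)
  have nC : Nonempty C := ⟨j1 (Classical.arbitrary S.B)⟩
  obtain ⟨D, sD, j2, g2, h2⟩ := exists_step (L := L) (g1 : S.B → C) j1
    (fun θ => (g1.map_formula θ id).trans (j1.map_formula θ id).symm)
  exact ⟨⟨C, D, sC, sD, nC, j2, g2⟩, j1, g1, h1, h2⟩

section Chain

variable {G : ℕ → Type w} [∀ n, L.Structure (G n)] (f : ∀ n, G n ↪ₑ[L] G (n + 1))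

theorem natLERec_succ (m n : ℕ) (h : m ≤ n) (x : G m) :
    DirectedSystem.natLERec (fun n => (f n).toEmbedding) m (n + 1) (Nat.le_succ_of_le h) x =
      f n (DirectedSystem.natLERec (fun n => (f n).toEmbedding) m n h x) := by
  simp only [DirectedSystem.coe_natLERec]
  rw [Nat.leRecOn_succ h]
  rfl

theorem natLERec_self (m : ℕ) (x : G m) :
    DirectedSystem.natLERec (fun n => (f n).toEmbedding) m m le_rfl x = x := by
  simp only [DirectedSystem.coe_natLERec]
  rw [Nat.leRecOn_self]

theorem natLERec_realize (m n : ℕ) (h : m ≤ n) {α : Type*} {k : ℕ} (φ : L.BoundedFormula α k)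
    (v : α → G m) (xs : Fin k → G m) :
    φ.Realize (fun a => DirectedSystem.natLERec (fun n => (f n).toEmbedding) m n h (v a))
      (fun a => DirectedSystem.natLERec (fun n => (f n).toEmbedding) m n h (xs a)) ↔
      φ.Realize v xs := by
  induction n, h using Nat.le_induction with
  | base => simp only [natLERec_self]
  | succ n h ih =>
    rw [← ih]
    simp only [natLERec_succ f m n h]
    exact (f n).map_boundedFormula φ _ _

/-- The direct limit of the chain. -/
abbrev Lim : Type w :=
  FirstOrder.Language.DirectLimit G (DirectedSystem.natLERec (fun n => (f n).toEmbedding))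

/-- The canonical map to the direct limit. -/
noncomputable def toLim (n : ℕ) : G n ↪[L] Lim f :=
  FirstOrder.Language.DirectLimit.of L ℕ G (DirectedSystem.natLERec (fun n => (f n).toEmbedding)) n

theorem toLim_le (m n : ℕ) (h : m ≤ n) (x : G m) :
    toLim f n (DirectedSystem.natLERec (fun n => (f n).toEmbedding) m n h x) = toLim f m x :=
  FirstOrder.Language.DirectLimit.of_f

theorem toLim_succ (n : ℕ) (x : G n) : toLim f (n + 1) (f n x) = toLim f n x := by
  rw [← toLim_le f n (n + 1) (Nat.le_succ n)]
  rw [natLERec_succ f n n le_rfl, natLERec_self]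

theorem exists_toLim (z : Lim f) : ∃ n x, toLim f n x = z :=
  FirstOrder.Language.DirectLimit.exists_of z

theorem toLim_realize {α : Type*} {k : ℕ} (φ : L.BoundedFormula α k) : ∀ (n : ℕ)
    (v : α → G n) (xs : Fin k → G n),
    φ.Realize (toLim f n ∘ v) (toLim f n ∘ xs) ↔ φ.Realize v xs := by
  induction φ with
  | falsum => intro n v xs; exact Iff.rfl
  | equal t₁ t₂ =>
    intro n v xs
    simp only [BoundedFormula.Realize, ← Sum.comp_elim, HomClass.realize_term]
    exact (toLim f n).injective.eq_iff
  | rel R ts =>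
    intro n v xs
    simp only [BoundedFormula.Realize, ← Sum.comp_elim, HomClass.realize_term]
    exact (toLim f n).map_rel R _
  | imp _ _ ih1 ih2 =>
    intro n v xs
    simp only [BoundedFormula.Realize, ih1, ih2]
  | all φ ih =>
    intro n v xs
    simp only [BoundedFormula.Realize]
    constructor
    · intro h a
      have := h (toLim f n a)
      rw [← Fin.comp_snoc] at this
      exact (ih n v _).1 this
    · intro h z
      obtain ⟨m, a, rfl⟩ := exists_toLim f z
      let F := DirectedSystem.natLERec (fun n => (f n).toEmbedding)
      have hn : n ≤ max n m := le_max_left _ _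
      have hm : m ≤ max n m := le_max_right _ _
      have h' : (BoundedFormula.all φ).Realize v xs := h
      rw [← natLERec_realize f n (max n m) hn] at h'
      have h2 := h' (F m (max n m) hm a)
      have h3 := (ih (max n m) _ _).2 h2
      rw [Fin.comp_snoc] at h3
      convert h3 using 1
      · funext i
        exact (toLim_le f n _ hn _).symm
      · congr 1
        · funext i
          exact (toLim_le f n _ hn _).symm
        · exact (toLim_le f m _ hm _).symm

/-- A compatible family of maps induces a map on the limit. -/
theorem exists_limMap (t : ∀ n, G n ↪ₑ[L] G (n + 1))
    (ht : ∀ n x, t (n + 1) (f n x) = f (n + 1) (t n x)) :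
    ∃ τ : Lim f ↪[L] Lim f, ∀ n x, τ (toLim f n x) = toLim f (n + 1) (t n x) := by
  have H : ∀ (i j : ℕ) (hij : i ≤ j) (x : G i),
      ((toLim f (j + 1)).comp (t j).toEmbedding)
        (DirectedSystem.natLERec (fun n => (f n).toEmbedding) i j hij x) =
      ((toLim f (i + 1)).comp (t i).toEmbedding) x := by
    intro i j hij x
    induction j, hij using Nat.le_induction with
    | base => rw [natLERec_self]
    | succ n h ih =>
      rw [← ih, natLERec_succ f i n h]
      change toLim f (n + 1 + 1) (t (n + 1) (f n _)) = toLim f (n + 1) (t n _)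
      rw [ht, toLim_succ]
  exact ⟨FirstOrder.Language.DirectLimit.lift L ℕ G _ _ H, fun n x => FirstOrder.Language.DirectLimit.lift_of _ _ x⟩

end Chain

theorem exists_aut {P : Type w} [L.Structure P] [Nonempty P] {E : Type w} (e e' : E → P)
    (h : ∀ θ : L.Formula E, θ.Realize e ↔ θ.Realize e') :
    ∃ (Q : Type w) (_ : L.Structure Q) (i : P ↪ₑ[L] Q) (τ : Q ≃[L] Q),
      ∀ x, τ (i (e x)) = i (e' x) := by
  obtain ⟨P', sP', j0, g0, h0⟩ := exists_step e e' h
  choose next jj gg h1 h2 using Stage.exists_next (L := L)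
  let S0 : Stage.{u, v, w} L := ⟨P, P', inferInstance, sP', inferInstance, j0, g0⟩
  let S : ℕ → Stage.{u, v, w} L := fun n => Nat.rec (motive := fun _ => Stage.{u, v, w} L) S0
    (fun _ s => next s) n
  have hS : ∀ n, S (n + 1) = next (S n) := fun n => rfl
  let G : ℕ → Type w := fun n => (S n).A
  letI sG : ∀ n : ℕ, L.Structure (G n) := fun n => (S n).sA
  let f : ∀ n : ℕ, G n ↪ₑ[L] G (n + 1) := fun n => (jj (S n)).comp (S n).j
  let t : ∀ n : ℕ, G n ↪ₑ[L] G (n + 1) := fun n => (jj (S n)).comp (S n).g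
  let r : ∀ n : ℕ, G n ↪ₑ[L] G (n + 1) := fun n => (gg (S n)).comp (S n).j
  have k1 : ∀ n (x : G n), gg (S n) ((S n).g x) = jj (S n) ((S n).j x) := fun n x => h1 (S n) x
  have k2 : ∀ n y, (S (n + 1)).g (gg (S n) y) = (S (n + 1)).j (jj (S n) y) := fun n y => h2 (S n) y
  obtain ⟨τ, hτ⟩ := exists_limMap f t (by
    intro n x
    change jj (S (n + 1)) ((S (n + 1)).g (jj (S n) ((S n).j x))) =
      jj (S (n + 1)) ((S (n + 1)).j (jj (S n) ((S n).g x)))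
    rw [← k1, k2])
  obtain ⟨ρ, hρ⟩ := exists_limMap f r (by
    intro n x
    change gg (S (n + 1)) ((S (n + 1)).j (jj (S n) ((S n).j x))) =
      jj (S (n + 1)) ((S (n + 1)).j (gg (S n) ((S n).j x)))
    exact (congrArg (gg (S (n + 1))) (k2 n ((S n).j x))).symm.trans (k1 (n + 1) _))
  have c1 : ∀ z, ρ (τ z) = z := by
    intro z
    obtain ⟨n, x, rfl⟩ := exists_toLim f z
    rw [hτ, hρ]
    rw [← toLim_succ f n, ← toLim_succ f (n + 1)]
    congr 1
    change gg (S (n + 1)) ((S (n + 1)).j (jj (S n) ((S n).g x))) =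
      jj (S (n + 1)) ((S (n + 1)).j (jj (S n) ((S n).j x)))
    exact ((congrArg (gg (S (n + 1))) (k2 n ((S n).g x))).symm.trans (k1 (n + 1) _)).trans
      (congrArg (fun y => jj (S (n + 1)) ((S (n + 1)).j y)) (k1 n x))
  have c2 : ∀ z, τ (ρ z) = z := by
    intro z
    obtain ⟨n, x, rfl⟩ := exists_toLim f z
    rw [hρ, hτ]
    rw [← toLim_succ f n, ← toLim_succ f (n + 1)]
    congr 1
    change jj (S (n + 1)) ((S (n + 1)).g (gg (S n) ((S n).j x))) =
      jj (S (n + 1)) ((S (n + 1)).j (jj (S n) ((S n).j x)))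
    rw [k2]
  let τ' : Lim f ≃[L] Lim f :=
    { toFun := τ
      invFun := ρ
      left_inv := c1
      right_inv := c2
      map_fun' := fun F x => τ.map_fun F x
      map_rel' := fun R x => τ.map_rel R x }
  refine ⟨Lim f, inferInstance, ⟨fun p : P => toLim f 0 p, fun n φ x => ?_⟩, τ', fun x => ?_⟩
  · have := toLim_realize f φ 0 x default
    rw [Subsingleton.elim (toLim f 0 ∘ default) default] at this
    exact this
  · change τ (toLim f 0 (e x)) = toLim f 0 (e' x)
    rw [hτ, ← toLim_succ f 0]
    congr 1
    change jj (S 0) (g0 (e x)) = jj (S 0) (j0 (e' x))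
    rw [h0]

end Extension

section Conclusion

open Filter

variable {L : Language.{u, v}}

theorem elementary_of_mc {L' : Language.{u, v}} {S Tm : L'.Theory}
    (hmc : IsModelCompletion.{u, v, w} S Tm)
    {M M' : Type w} [L'.Structure M] [L'.Structure M'] [Nonempty M]
    (hM : M ⊨ Tm) (hM' : M' ⊨ Tm) (f : M ↪[L'] M') {α : Type*} (φ : L'.Formula α) (v : α → M)
    (hv : φ.Realize v) : φ.Realize (f ∘ v) := by
  have nM' : Nonempty M' := ⟨f (Classical.arbitrary M)⟩
  have hS : M ⊨ S := Theory.Model.mono hM hmc.1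
  letI : (constantsOn M).Structure M' := constantsOn.structure f
  let f' : M ↪[L'[[M]]] M' := by
    refine ⟨f.toEmbedding, ?_, ?_⟩
    · intro n g x
      cases g with
      | inl g => exact f.map_fun' g x
      | inr g =>
        cases n with
        | zero => rfl
        | succ n => exact isEmptyElim g
    · intro n R x
      cases R with
      | inl R => exact f.map_rel' R x
      | inr R => exact isEmptyElim R
  have key : (L'.lhomWithConstants M).onTheory Tm ∪ atomicDiagram L' M ⊨ᵇ
        Formula.equivSentence (φ.relabel v) ∨
      (L'.lhomWithConstants M).onTheory Tm ∪ atomicDiagram L' M ⊨ᵇ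
        ∼(Formula.equivSentence (φ.relabel v)) :=
    (hmc.2.2 (Theory.ModelType.of S M)).2 (Formula.equivSentence (φ.relabel v))
  have m1 : M ⊨ (L'.lhomWithConstants M).onTheory Tm ∪ atomicDiagram L' M :=
    Theory.model_union_iff.2 ⟨(LHom.onTheory_model _ _).2 hM, ⟨fun ψ hψ => hψ.2⟩⟩
  have hat : ∀ ψ : (L'[[M]]).Sentence, ψ.IsAtomic → (M' ⊨ ψ ↔ M ⊨ ψ) := by
    intro ψ hψ
    have := hψ.isQF.realize_embedding f' (v := default) (xs := default)
    rw [Subsingleton.elim (f' ∘ default) default, Subsingleton.elim (f' ∘ default) default] at this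
    exact this
  have m2 : M' ⊨ (L'.lhomWithConstants M).onTheory Tm ∪ atomicDiagram L' M := by
    refine Theory.model_union_iff.2 ⟨(LHom.onTheory_model _ _).2 hM', ⟨?_⟩⟩
    rintro ψ ⟨hψ | ⟨χ, hχ, rfl⟩, h⟩
    · exact (hat ψ hψ).2 h
    · rw [Sentence.realize_not] at h ⊢
      rwa [hat χ hχ]
  have r1 : M ⊨ Formula.equivSentence (φ.relabel v) := by
    rw [Formula.realize_equivSentence, Formula.realize_relabel]
    exact hv
  rcases key with key | key
  · have := key.realize_sentence M'
    rw [Formula.realize_equivSentence, Formula.realize_relabel] at this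
    exact this
  · have := key.realize_sentence M
    rw [Sentence.realize_not] at this
    exact absurd r1 this

theorem exists_emb {I N Q : Type*} [(LPlus L).Structure N] [L.Structure N]
    [(LHom.sumInl : L →ᴸ LPlus L).IsExpansionOn N] [Nonempty N]
    [(LPlus L).Structure Q] [L.Structure Q]
    [(LHom.sumInl : L →ᴸ LPlus L).IsExpansionOn Q]
    (W : Ultrafilter I) (E : (I → N) → Q)
    (hE : ∀ θ : L.Formula (I → N), θ.Realize E ↔ ∀ᶠ j in W, θ.Realize (fun x => x j))
    (hs : ∀ x, sigmaMap L Q (E x) = E (fun j => sigmaMap L N (x j))) :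
    ∃ f : (W : Filter I).Product (fun _ => N) ↪[LPlus L] Q,
      ∀ x : I → N, f (x : (W : Filter I).Product (fun _ => N)) = E x := by
  have heq : ∀ x y : I → N, E x = E y ↔ ∀ᶠ j in W, x j = y j := by
    intro x y
    have := hE (Term.equal (Term.var x) (Term.var y))
    simpa only [Formula.realize_equal, Term.realize_var] using this
  have hfun : ∀ (n : ℕ) (F : L.Functions n) (y : Fin n → I → N),
      E (fun j => funMap F (fun i => y i j)) = funMap F (fun i => E (y i)) := by
    intro n F y
    have := (hE (Term.equal (Term.var (fun j => funMap F (fun i => y i j)))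
      (Term.func F (fun i => Term.var (y i))))).2
    simp only [Formula.realize_equal, Term.realize_var, Term.realize_func] at this
    exact this (Eventually.of_forall fun j => trivial)
  have hrel : ∀ (n : ℕ) (R : L.Relations n) (y : Fin n → I → N),
      RelMap R (fun i => E (y i)) ↔ ∀ᶠ j in W, RelMap R (fun i => y i j) := by
    intro n R y
    have := hE (R.formula (fun i => Term.var (y i)))
    simpa only [Formula.realize_rel, Term.realize_var] using this
  let f0 : (W : Filter I).Product (fun _ => N) → Q :=
    Quotient.lift E (fun x y h => (heq x y).2 h)
  have hf0 : ∀ x : I → N, f0 (x : (W : Filter I).Product (fun _ => N)) = E x := fun x => rfl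
  have rep : ∀ (n : ℕ) (x : Fin n → (W : Filter I).Product (fun _ => N)),
      ∃ y : Fin n → I → N, x = fun i => (y i : (W : Filter I).Product (fun _ => N)) := by
    intro n x
    choose y hy using fun i => Quotient.exists_rep (x i)
    exact ⟨y, funext fun i => (hy i).symm⟩
  refine ⟨⟨⟨f0, ?_⟩, ?_, ?_⟩, hf0⟩
  · intro x y
    induction x using Quotient.inductionOn
    induction y using Quotient.inductionOn
    intro h
    exact Quotient.sound ((heq _ _).1 h)
  · intro n F x
    obtain ⟨y, rfl⟩ := rep n x
    cases F with
    | inl F =>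
      have h1 := Ultraproduct.funMap_cast (M := fun _ => N) (u := W) (L := LPlus L)
        (Sum.inl F) y
      refine (congrArg f0 h1).trans ?_
      have h2 : ∀ z : Fin n → N, @funMap (LPlus L) N _ n (Sum.inl F) z = funMap F z :=
        fun z => LHom.map_onFunction (LHom.sumInl : L →ᴸ LPlus L) F z
      have h3 : ∀ z : Fin n → Q, @funMap (LPlus L) Q _ n (Sum.inl F) z = funMap F z :=
        fun z => LHom.map_onFunction (LHom.sumInl : L →ᴸ LPlus L) F z
      rw [h3]
      simp only [h2]
      exact hfun n F y
    | inr F =>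
      cases F
      have h1 := Ultraproduct.funMap_cast (M := fun _ => N) (u := W) (sigmaSymb L) y
      refine (congrArg f0 h1).trans ?_
      have h2 : ∀ (z : Fin 1 → N),
          funMap (sigmaSymb L) z = sigmaMap L N (z 0) := by
        intro z
        rw [sigmaMap]
        congr 1
        funext i
        rw [Subsingleton.elim i 0]
        rfl
      have h3 : ∀ (z : Fin 1 → Q),
          funMap (sigmaSymb L) z = sigmaMap L Q (z 0) := by
        intro z
        rw [sigmaMap]
        congr 1
        funext i
        rw [Subsingleton.elim i 0]
        rfl
      refine Eq.trans ?_ (h3 _).symm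
      refine Eq.trans ?_ (hs (y 0)).symm
      refine (hf0 _).trans (congrArg E ?_)
      funext j
      exact h2 fun i => y i j
  · intro n R x
    obtain ⟨y, rfl⟩ := rep n x
    cases R with
    | inl R =>
      have h0 : ∀ R' : (LPlus L).Relations n,
          RelMap R' (fun i => (y i : (W : Filter I).Product (fun _ => N))) ↔
            ∀ᶠ j in W, RelMap R' (fun i => y i j) := by
        intro R'
        have h1 := Ultraproduct.realize_formula_cast (M := fun _ => N) (u := W)
          (R'.formula (fun i => Term.var (y i))) (fun z => z)
        simp only [Formula.realize_rel, Term.realize_var] at h1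
        exact h1
      have h1 := h0 (Sum.inl R)
      refine Iff.trans ?_ h1.symm
      have h2 : ∀ z : Fin n → N, @RelMap (LPlus L) N _ n (Sum.inl R) z = RelMap R z :=
        fun z => LHom.map_onRelation (LHom.sumInl : L →ᴸ LPlus L) R z
      have h3 : ∀ z : Fin n → Q, @RelMap (LPlus L) Q _ n (Sum.inl R) z = RelMap R z :=
        fun z => LHom.map_onRelation (LHom.sumInl : L →ᴸ LPlus L) R z
      refine (iff_of_eq (h3 _)).trans ((hrel n R y).trans ?_)
      exact eventually_congr (Eventually.of_forall fun j => iff_of_eq (h2 _).symm)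
    | inr R => exact R.elim

section TautModel

variable {N : Type*} [(LPlus L).Structure N] [L.Structure N]
    [(LHom.sumInl : L →ᴸ LPlus L).IsExpansionOn N]

theorem realize_sigmaTerm {α : Type*} (t : (LPlus L).Term α) (v : α → N) :
    (sigmaTerm t).realize v = sigmaMap L N (t.realize v) := by
  simp only [sigmaTerm, Term.realize_functions_apply₁, sigmaMap]

theorem realize_sigmaInj : N ⊨ sigmaInj L ↔ Function.Injective (sigmaMap L N) := by
  simp only [sigmaInj, Sentence.Realize, Formula.Realize, BoundedFormula.realize_all,
    BoundedFormula.realize_imp, BoundedFormula.realize_bdEqual, realize_sigmaTerm,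
    Term.realize_var, Function.comp_apply]
  exact Iff.rfl

theorem realize_sigmaSurj : N ⊨ sigmaSurj L ↔ Function.Surjective (sigmaMap L N) := by
  simp only [sigmaSurj, Sentence.Realize, Formula.Realize, BoundedFormula.realize_all,
    BoundedFormula.realize_ex, BoundedFormula.realize_bdEqual, realize_sigmaTerm,
    Term.realize_var, Function.comp_apply]
  exact Iff.rfl

theorem realize_funComm {n : ℕ} (F : L.Functions n) : N ⊨ funCommSentence L F ↔
    ∀ x : Fin n → N, sigmaMap L N (funMap F x) = funMap F (fun i => sigmaMap L N (x i)) := by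
  have h3 : ∀ z : Fin n → N, @funMap (LPlus L) N _ n (Sum.inl F) z = funMap F z :=
    fun z => LHom.map_onFunction (LHom.sumInl : L →ᴸ LPlus L) F z
  simp only [funCommSentence, Sentence.Realize, BoundedFormula.realize_alls,
    BoundedFormula.realize_bdEqual, realize_sigmaTerm]
  refine forall_congr' fun x => ?_
  have e1 : (fun i => (sigmaTerm (Term.var (Sum.inr i) : (LPlus L).Term (Empty ⊕ Fin n))).realize
      (Sum.elim default x)) = fun i => sigmaMap L N (x i) :=
    funext fun i => realize_sigmaTerm _ _
  rw [← h3, ← h3, ← e1]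
  exact Iff.rfl

theorem realize_relPres {n : ℕ} (R : L.Relations n) : N ⊨ relPresSentence L R ↔
    ∀ x : Fin n → N, RelMap R x ↔ RelMap R (fun i => sigmaMap L N (x i)) := by
  have h3 : ∀ z : Fin n → N, @RelMap (LPlus L) N _ n (Sum.inl R) z = RelMap R z :=
    fun z => LHom.map_onRelation (LHom.sumInl : L →ᴸ LPlus L) R z
  simp only [relPresSentence, Sentence.Realize, BoundedFormula.realize_alls,
    BoundedFormula.realize_iff]
  refine forall_congr' fun x => ?_
  have e1 : (fun i => (sigmaTerm (Term.var (Sum.inr i) : (LPlus L).Term (Empty ⊕ Fin n))).realize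
      (Sum.elim default x)) = fun i => sigmaMap L N (x i) :=
    funext fun i => realize_sigmaTerm _ _
  rw [← h3, ← h3, ← e1]
  exact Iff.rfl

theorem taut_of {T : L.Theory} (hT : N ⊨ T) (h1 : Function.Injective (sigmaMap L N))
    (h2 : Function.Surjective (sigmaMap L N))
    (h3 : ∀ (n : ℕ) (F : L.Functions n) (x : Fin n → N),
      sigmaMap L N (funMap F x) = funMap F (fun i => sigmaMap L N (x i)))
    (h4 : ∀ (n : ℕ) (R : L.Relations n) (x : Fin n → N),
      RelMap R x ↔ RelMap R (fun i => sigmaMap L N (x i))) : N ⊨ Taut T := by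
  refine Theory.model_union_iff.2 ⟨Theory.model_union_iff.2 ⟨Theory.model_union_iff.2
    ⟨(LHom.onTheory_model _ _).2 hT, ⟨?_⟩⟩, ⟨?_⟩⟩, ⟨?_⟩⟩
  · rintro φ (rfl | rfl)
    · exact realize_sigmaInj.2 h1
    · exact realize_sigmaSurj.2 h2
  · rintro φ ⟨n, F, rfl⟩
    exact (realize_funComm F).2 (h3 n F)
  · rintro φ ⟨n, R, rfl⟩
    exact (realize_relPres R).2 (h4 n R)

theorem exists_sigma {T : L.Theory} (hN : N ⊨ Taut T) :
    N ⊨ T ∧ ∃ σ : N ≃[L] N, ∀ x, σ x = sigmaMap L N x := by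
  obtain ⟨h, h4⟩ := Theory.model_union_iff.1 hN
  obtain ⟨h, h3⟩ := Theory.model_union_iff.1 h
  obtain ⟨h, h2⟩ := Theory.model_union_iff.1 h
  refine ⟨(LHom.onTheory_model _ _).1 h, ?_⟩
  have i1 := realize_sigmaInj.1 (h2.realize_of_mem _ (Or.inl rfl))
  have i2 := realize_sigmaSurj.1 (h2.realize_of_mem _ (Or.inr rfl))
  refine ⟨⟨Equiv.ofBijective _ ⟨i1, i2⟩, ?_, ?_⟩, fun x => rfl⟩
  · intro n F x
    exact (realize_funComm F).1 (h3.realize_of_mem _ ⟨n, F, rfl⟩) x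
  · intro n R x
    exact ((realize_relPres R).1 (h4.realize_of_mem _ ⟨n, R, rfl⟩) x).symm

end TautModel

/-- The structure on the one-symbol language given by a function. -/
@[reducible]
def sigmaStr {Q : Type*} (τ : Q → Q) : sigmaLang.Structure Q where
  funMap := fun {_} f x => match f with
    | SigmaFunc.sigma => τ (x 0)
  RelMap := fun {_} r _ => r.elim

theorem main_aux
    (L : Language.{u, v}) (T : L.Theory)
    (hstable : IsStableTheory.{u, v, w} T)
    (Tmc : (LPlus L).Theory)
    (hmc : IsModelCompletion.{u, v, w} (Taut T) Tmc)
    (Tstar : (LPlus L).Theory) (hc : Tmc ⊆ Tstar) :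
    ¬ HasSOP3.{u, v, w} Tstar := by
  rintro ⟨n, φ, ⟨N, a, ha⟩, hno⟩
  letI : L.Structure N := (LHom.sumInl : L →ᴸ LPlus L).reduct N
  have hNstar : N ⊨ Tstar := N.is_model
  have hNT : N ⊨ Taut T := Theory.Model.mono hNstar (hmc.1.trans hc)
  obtain ⟨hNT0, σ, hσ⟩ := exists_sigma hNT
  have hlad := noLadder_of_stable hstable N hNT0
  let U : Ultrafilter ℕ := hyperfilter ℕ
  obtain ⟨P, sP, nP, e01, e12, e20, hsent, h01, h12, h20, k0, k1, k2, hinv⟩ :=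
    exists_amalgam hlad U σ
  obtain ⟨Q, sQ, i, τ, hτ⟩ := exists_aut _ _ hinv
  letI : sigmaLang.Structure Q := sigmaStr τ
  have hsig : ∀ q, sigmaMap L Q q = τ q := fun q => rfl
  have nQ : Nonempty Q := ⟨i (Classical.arbitrary P)⟩
  have hQT0 : Q ⊨ T := by
    refine ⟨fun ψ hψ => ?_⟩
    rw [← i.map_sentence ψ, hsent]
    exact hNT0.realize_of_mem ψ hψ
  have hQ : Q ⊨ Taut T := by
    refine taut_of hQT0 τ.injective τ.surjective ?_ ?_
    · intro n F x
      exact τ.map_fun F x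
    · intro n R x
      exact (τ.map_rel R x).symm
  obtain ⟨N', ⟨g⟩⟩ := hmc.2.1 (Theory.ModelType.of (Taut T) Q)
  let W := tens U U
  let NU := (W : Filter (ℕ × ℕ)).Product (fun _ => (N : Type w))
  letI sNU : (LPlus L).Structure NU :=
    Ultraproduct.structure (M := fun _ => (N : Type w)) (L := LPlus L) (u := W)
  have hNU : NU ⊨ Tstar := by
    refine ⟨fun ψ hψ => ?_⟩
    refine (Ultraproduct.sentence_realize (M := fun _ => (N : Type w)) ψ).2 ?_
    exact Eventually.of_forall fun _ => hNstar.realize_of_mem ψ hψ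
  have hNU' : NU ⊨ Tmc := Theory.Model.mono hNU hc
  have hN' : N' ⊨ Tmc := N'.is_model
  have emb : ∀ E : (ℕ × ℕ → N) → P,
      (∀ θ : L.Formula (ℕ × ℕ → N), θ.Realize E ↔ ∀ᶠ j in W, θ.Realize (fun x => x j)) →
      (∀ x, τ (i (E x)) = i (E fun j => σ (x j))) →
      ∃ f : NU ↪[LPlus L] N', ∀ x : ℕ × ℕ → N, f (x : NU) = g (i (E x)) := by
    intro E hE hs
    obtain ⟨f, hf⟩ := exists_emb (L := L) (N := N) (Q := Q) W (fun x => i (E x))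
      (fun θ => (i.map_formula θ E).trans (hE θ))
      (fun x => by rw [hsig, hs]; simp only [hσ])
    exact ⟨g.comp f, fun x => congrArg g (hf x)⟩
  obtain ⟨f01, hf01⟩ := emb e01 h01 (fun x => hτ (Sum.inl (Sum.inl x)))
  obtain ⟨f12, hf12⟩ := emb e12 h12 (fun x => hτ (Sum.inr x))
  obtain ⟨f20, hf20⟩ := emb e20 h20 (fun x => hτ (Sum.inl (Sum.inr x)))
  have hN'star : N' ⊨ Tstar := by
    refine ⟨fun ψ hψ => ?_⟩
    have := elementary_of_mc hmc hNU' hN' f01 ψ default (hNU.realize_of_mem ψ hψ)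
    rw [Subsingleton.elim (f01 ∘ default) default] at this
    exact this
  let c : Fin n ⊕ Fin n → ℕ × ℕ → N := Sum.elim (fun k j => a j.1 k) (fun k j => a j.2 k)
  have hφ : @Formula.Realize (LPlus L) NU sNU _ φ (fun k => (c k : NU)) := by
    refine (Ultraproduct.realize_formula_cast (M := fun _ => (N : Type w)) φ c).2 ?_
    refine (eventually_tens U U _).2 (Eventually.of_forall fun p => ?_)
    have : ∀ᶠ q in (U : Filter ℕ), p < q := by
      refine hyperfilter_le_cofinite ?_
      rw [Nat.cofinite_eq_atTop]
      exact eventually_gt_atTop p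
    refine this.mono fun q hq => ?_
    have := ha p q hq
    convert this using 1
    funext k
    cases k <;> rfl
  have r01 := elementary_of_mc hmc hNU' hN' f01 φ _ hφ
  have r12 := elementary_of_mc hmc hNU' hN' f12 φ _ hφ
  have r20 := elementary_of_mc hmc hNU' hN' f20 φ _ hφ
  have q01 : (fun k => f01 (c k : NU)) = Sum.elim (fun k => g (i (e01 fun j => a j.1 k)))
      (fun k => g (i (e12 fun j => a j.1 k))) := by
    funext k
    refine (hf01 _).trans ?_
    cases k with
    | inl k => rfl
    | inr k => exact congrArg (fun z => g (i z)) (k1 fun p => a p k)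
  have q12 : (fun k => f12 (c k : NU)) = Sum.elim (fun k => g (i (e12 fun j => a j.1 k)))
      (fun k => g (i (e20 fun j => a j.1 k))) := by
    funext k
    refine (hf12 _).trans ?_
    cases k with
    | inl k => rfl
    | inr k => exact congrArg (fun z => g (i z)) (k2 fun p => a p k)
  have q20 : (fun k => f20 (c k : NU)) = Sum.elim (fun k => g (i (e20 fun j => a j.1 k)))
      (fun k => g (i (e01 fun j => a j.1 k))) := by
    funext k
    refine (hf20 _).trans ?_
    cases k with
    | inl k => rfl
    | inr k => exact congrArg (fun z => g (i z)) (k0 fun p => a p k).symm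
  have s01 : φ.Realize (fun k => f01 (c k : NU)) := r01
  have s12 : φ.Realize (fun k => f12 (c k : NU)) := r12
  have s20 : φ.Realize (fun k => f20 (c k : NU)) := r20
  rw [q01] at s01
  rw [q12] at s12
  rw [q20] at s20
  exact hno (Theory.ModelType.of Tstar N') _ _ _ ⟨s01, s12, s20⟩

end Conclusion

theorem completion_of_modelCompletion_NSOP3
    (L : Language.{u, v}) (T : L.Theory) (hT : SemComplete T)
    (hstable : IsStableTheory.{u, v, w} T)
    (Tmc : (LPlus L).Theory)
    (hmc : IsModelCompletion.{u, v, w} (Taut T) Tmc)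
    (Tstar : (LPlus L).Theory) (hc : IsCompletionOf Tmc Tstar) :
    ¬ HasSOP3.{u, v, w} Tstar := by
  exact main_aux L T hstable Tmc hmc Tstar hc.1

end ShelahE34

end FirstOrder
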